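/- arXiv:math/0306257 — 7 statements merged into one kernel-verified Lean document; each statement's English description precedes it below -/
import Mathlib

section
/- Let h be a permutation of a finite set X, and let s and t be points lying in two distinct nontrivial cycles of h, of lengths i ≥ 2 and j ≥ 2 respectively. Then the cycle type of the product (s t)·h is obtained from the cycle type of h by removing one part equal to i and one part equal to j and adding one part equal to i+j. (Multiplying by a transposition of points in two different cycles joins the i-cycle and the j-cycle into an (i+j)-cycle.) -/
namespace Equiv.Perm

theorem card_support_cycleOf_eq_minimalPeriod {X : Type*} [Fintype X] [DecidableEq X]
    {h : Perm X} {x : X} (hx : h x ≠ x) :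
    (h.cycleOf x).support.card = Function.minimalPeriod h x := by
  have hc := isCycle_cycleOf h hx
  have hx' : h.cycleOf x x ≠ x := by rwa [cycleOf_apply_self]
  have key (n : ℕ) : orderOf (h.cycleOf x) ∣ n ↔ Function.minimalPeriod h x ∣ n := by
    rw [orderOf_dvd_iff_pow_eq_one, hc.pow_eq_one_iff' hx', cycleOf_pow_apply_self,
      ← Function.isPeriodicPt_iff_minimalPeriod_dvd, Function.IsPeriodicPt,
      Function.IsFixedPt, iterate_eq_pow]
  rw [← hc.orderOf]
  exact Nat.dvd_antisymm ((key _).2 dvd_rfl) ((key _).1 dvd_rfl)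

theorem swap_mul_pow_apply_of_lt_minimalPeriod {X : Type*} [DecidableEq X]
    {h : Perm X} {s t : X} (hst : ¬ h.SameCycle s t) {n : ℕ}
    (hn : n < Function.minimalPeriod h s) : ((swap s t * h) ^ n) s = (h ^ n) s := by
  induction n with
  | zero => rfl
  | succ n ih =>
    rw [pow_succ', mul_apply, ih (by lia), mul_apply, ← mul_apply h, ← pow_succ']
    refine swap_apply_of_ne_of_ne (fun e => ?_) (fun e => hst ⟨(n + 1 : ℕ), e⟩)
    refine Function.not_isPeriodicPt_of_pos_of_lt_minimalPeriod n.succ_ne_zero hn ?_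
    rwa [Function.IsPeriodicPt, Function.IsFixedPt, iterate_eq_pow]

theorem SameCycle.swap_mul {X : Type*} [Finite X] [DecidableEq X] {h : Perm X} {s t x : X}
    (hx : h.SameCycle s x) (hst : ¬ h.SameCycle s t) : (swap s t * h).SameCycle s x := by
  obtain ⟨n, rfl⟩ := hx.exists_nat_pow_eq
  have hs : s ∈ Function.periodicPts h := h.injective.mem_periodicPts s
  have hlt := Nat.mod_lt n (Function.minimalPeriod_pos_of_mem_periodicPts hs)
  refine ⟨(n % Function.minimalPeriod h s : ℕ), ?_⟩
  rw [zpow_natCast, swap_mul_pow_apply_of_lt_minimalPeriod hst hlt, ← iterate_eq_pow,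
    ← iterate_eq_pow, Function.iterate_mod_minimalPeriod_eq]

theorem sameCycle_swap_mul_of_not_sameCycle {X : Type*} [Finite X] [DecidableEq X]
    {h : Perm X} {s t : X} (hst : ¬ h.SameCycle s t) : (swap s t * h).SameCycle s t := by
  have hs : h.SameCycle s (h.symm s) := sameCycle_symm_apply_right.2 .rfl
  simpa using sameCycle_apply_right.2 (hs.swap_mul hst)

theorem support_swap_mul_of_not_sameCycle {X : Type*} [Fintype X] [DecidableEq X]
    {h : Perm X} {s t : X} (hst : ¬ h.SameCycle s t) (hs : h s ≠ s) (ht : h t ≠ t) :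
    (swap s t * h).support = h.support := by
  have hs' : h s ≠ t := fun e => hst ⟨1, by simpa using e⟩
  have ht' : h t ≠ s := fun e => hst (SameCycle.symm ⟨1, by simpa using e⟩)
  ext x
  rw [mem_support, mem_support, mul_apply, ne_eq, ne_eq, not_iff_not, swap_apply_eq_iff]
  by_cases hxs : x = s
  · subst hxs; simp [hs, hs']
  by_cases hxt : x = t
  · subst hxt; simp [ht, ht']
  rw [swap_apply_of_ne_of_ne hxs hxt]

theorem isCycle_swap_mul_of_not_sameCycle {X : Type*} [Fintype X] [DecidableEq X]
    {h : Perm X} {s t : X} (hst : ¬ h.SameCycle s t) (hs : h s ≠ s) (ht : h t ≠ t)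
    (hX : ∀ x, h x ≠ x → h.SameCycle s x ∨ h.SameCycle t x) : (swap s t * h).IsCycle := by
  have hsupp := support_swap_mul_of_not_sameCycle hst hs ht
  refine ⟨s, mem_support.1 (hsupp ▸ mem_support.2 hs), fun x hx => ?_⟩
  rcases hX x (mem_support.1 (hsupp ▸ mem_support.2 hx)) with hsx | htx
  · exact hsx.swap_mul hst
  · refine (sameCycle_swap_mul_of_not_sameCycle hst).trans ?_
    rw [swap_comm]
    exact htx.swap_mul fun e => hst e.symm

theorem Disjoint.zpow_mul_apply_of_mem_support {X : Type*} [Fintype X] [DecidableEq X]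
    {a b : Perm X} (hab : a.Disjoint b) {x : X} (hx : x ∈ a.support) (n : ℤ) :
    ((a * b) ^ n) x = (a ^ n) x := by
  rw [hab.commute.mul_zpow, mul_apply,
    zpow_apply_eq_self_of_apply_eq_self ((hab x).resolve_left (mem_support.1 hx))]

theorem Disjoint.cycleType_swap_mul_mul {X : Type*} [Fintype X] [DecidableEq X]
    {a b : Perm X} (hab : a.Disjoint b) (ha : a.IsCycle) (hb : b.IsCycle) {s t : X}
    (hs : s ∈ a.support) (ht : t ∈ b.support) :
    (swap s t * (a * b)).cycleType = {a.support.card + b.support.card} ∧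
      (swap s t * (a * b)).support = a.support ∪ b.support := by
  have hst : ¬ (a * b).SameCycle s t := by
    rintro ⟨n, hn⟩
    rw [hab.zpow_mul_apply_of_mem_support hs] at hn
    exact Finset.disjoint_left.1 hab.disjoint_support
      (hn ▸ zpow_apply_mem_support.2 hs) ht
  have hs' : (a * b) s ≠ s := by
    rw [← mem_support, hab.support_mul]; exact Finset.mem_union_left _ hs
  have ht' : (a * b) t ≠ t := by
    rw [← mem_support, hab.support_mul]; exact Finset.mem_union_right _ ht
  have hsupp := (support_swap_mul_of_not_sameCycle hst hs' ht').trans hab.support_mul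
  refine ⟨?_, hsupp⟩
  rw [← Finset.card_union_of_disjoint hab.disjoint_support, ← hsupp]
  refine (isCycle_swap_mul_of_not_sameCycle hst hs' ht' fun x hx => ?_).cycleType
  rw [← mem_support, hab.support_mul, Finset.mem_union] at hx
  refine hx.imp (fun hx => ?_) fun hx => ?_
  · obtain ⟨n, hn⟩ := ha.sameCycle (mem_support.1 hs) (mem_support.1 hx)
    exact ⟨n, by rw [hab.zpow_mul_apply_of_mem_support hs, hn]⟩
  · obtain ⟨n, hn⟩ := hb.sameCycle (mem_support.1 ht) (mem_support.1 hx)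
    exact ⟨n, by rw [hab.commute.eq, hab.symm.zpow_mul_apply_of_mem_support ht, hn]⟩

theorem exists_disjoint_mul_cycleOf_mul_cycleOf {X : Type*} [Fintype X] [DecidableEq X]
    {h : Perm X} {s t : X} (hst : ¬ h.SameCycle s t) (hs : h s ≠ s) (ht : h t ≠ t) :
    (h.cycleOf s).Disjoint (h.cycleOf t) ∧
      ∃ k : Perm X, (h.cycleOf s * h.cycleOf t).Disjoint k ∧
        h = h.cycleOf s * h.cycleOf t * k := by
  have ha : h.cycleOf s ∈ h.cycleFactorsFinset :=
    cycleOf_mem_cycleFactorsFinset_iff.2 (mem_support.2 hs)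
  have hb : h.cycleOf t ∈ h.cycleFactorsFinset :=
    cycleOf_mem_cycleFactorsFinset_iff.2 (mem_support.2 ht)
  have hne : h.cycleOf s ≠ h.cycleOf t := fun e =>
    hst ((sameCycle_iff_cycleOf_eq_of_mem_support (mem_support.2 hs) (mem_support.2 ht)).2 e)
  have hab := h.cycleFactorsFinset_pairwise_disjoint ha hb hne
  generalize h.cycleOf s = a at *
  generalize h.cycleOf t = b at *
  have hb' : b ∈ (h * a⁻¹).cycleFactorsFinset := by
    rw [cycleFactorsFinset_mul_inv_mem_eq_sdiff ha]
    simp [hb, hne.symm]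
  have hk := disjoint_mul_inv_of_mem_cycleFactorsFinset hb'
  have hka : (h * a⁻¹ * b⁻¹).Disjoint a :=
    (disjoint_mul_inv_of_mem_cycleFactorsFinset ha).mul_left hab.symm.inv_left
  have hd := (hka.mul_right hk).symm
  refine ⟨hab, _, hd, ?_⟩
  rw [hd.commute.eq, hab.commute.eq]
  group

end Equiv.Perm


/-- Joining two cycles: let `h` be a permutation of a finite set `X`, and let `s` and `t`
lie in two distinct nontrivial cycles of `h`, of lengths `i ≥ 2` and `j ≥ 2` respectively
(the lengths being the minimal periods of `h` at `s` and at `t`).  Then the cycle type of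
`(s t)·h` is obtained from the cycle type of `h` by removing one part equal to `i` and one
part equal to `j` and adding one part equal to `i + j`. -/
theorem cycleType_swap_mul_of_not_sameCycle {X : Type*} [Fintype X] [DecidableEq X]
    (h : Equiv.Perm X) (s t : X) (hcyc : ¬ h.SameCycle s t)
    (i j : ℕ) (hi : i = Function.minimalPeriod h s) (hj : j = Function.minimalPeriod h t)
    (hi2 : 2 ≤ i) (hj2 : 2 ≤ j) :
    (Equiv.swap s t * h).cycleType
      = (h.cycleType.erase i).erase j + {i + j} := by
  have hs : h s ≠ s := fun e => by
    have := (Function.minimalPeriod_eq_one_iff_isFixedPt (f := h)).2 e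
    lia
  have ht : h t ≠ t := fun e => by
    have := (Function.minimalPeriod_eq_one_iff_isFixedPt (f := h)).2 e
    lia
  rw [← Equiv.Perm.card_support_cycleOf_eq_minimalPeriod hs] at hi
  rw [← Equiv.Perm.card_support_cycleOf_eq_minimalPeriod ht] at hj
  have ha := h.isCycle_cycleOf hs
  have hb := h.isCycle_cycleOf ht
  have hsa : s ∈ (h.cycleOf s).support := by simpa using hs
  have htb : t ∈ (h.cycleOf t).support := by simpa using ht
  obtain ⟨hab, k, hk, hh⟩ := Equiv.Perm.exists_disjoint_mul_cycleOf_mul_cycleOf hcyc hs ht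
  generalize h.cycleOf s = a at *
  generalize h.cycleOf t = b at *
  obtain ⟨htype, hsupp⟩ := hab.cycleType_swap_mul_mul ha hb hsa htb
  have hk' : (Equiv.swap s t * (a * b)).Disjoint k := by
    rw [Equiv.Perm.disjoint_iff_disjoint_support, hsupp, ← hab.support_mul]
    exact hk.disjoint_support
  rw [hh, ← mul_assoc, hk'.cycleType_mul, htype, hk.cycleType_mul, hab.cycleType_mul,
    ha.cycleType, hb.cycleType, ← hi, ← hj, add_assoc, Multiset.singleton_add i,
    Multiset.erase_cons_head, Multiset.singleton_add j, Multiset.erase_cons_head, add_comm]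
end

section
/- Let h be a permutation of a finite set X with cycle type μ, and let i, j be integers with i, j ≥ 2 and i ≠ j. Then the number of transpositions τ of X such that the cycle type of τ·h equals the multiset obtained from μ by removing one copy of i+j and adding one copy of i and one copy of j is exactly (i+j)·m_{i+j}(μ). -/
open Equiv Equiv.Perm

section

variable {X : Type*} [DecidableEq X]

theorem List.formPerm_cons_append_cons {x y : X} {l₁ l₂ : List X}
    (hd : (x :: l₁ ++ y :: l₂).Nodup) :
    (x :: l₁ ++ y :: l₂).formPerm =
      Equiv.swap x y * ((x :: l₁).formPerm * (y :: l₂).formPerm) := by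
  induction l₁ generalizing x with
  | nil => simp
  | cons z l ih =>
    have hxz : x ≠ z := by rintro rfl; simp at hd
    have hxy : x ≠ y := by rintro rfl; simp at hd
    have hzy : z ≠ y := by rintro rfl; simp at hd
    have h := ih (x := z) (List.nodup_cons.1 hd).2
    have hs : Equiv.swap x z * Equiv.swap z y = Equiv.swap x y * Equiv.swap x z := by
      rw [mul_swap_eq_swap_mul, swap_apply_right, swap_apply_of_ne_of_ne hxy.symm hzy.symm]
    simp only [List.cons_append, List.formPerm_cons_cons] at h ⊢
    rw [h, ← mul_assoc, hs]
    simp only [mul_assoc]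

variable [Fintype X]

theorem List.Nodup.cycleType_formPerm {l : List X} (hl : l.Nodup) :
    l.formPerm.cycleType = Multiset.filter (2 ≤ ·) {l.length} := by
  match l with
  | [] => simp [Multiset.filter_singleton]
  | [x] => simp [Multiset.filter_singleton]
  | x :: y :: l =>
    rw [(List.isCycle_formPerm hl (by simp)).cycleType,
      List.support_formPerm_of_nodup _ hl (by simp), List.toFinset_card_of_nodup hl]
    simp [Multiset.filter_singleton]

namespace Equiv.Perm

/-- Multiplying by the transposition of two points of a cycle, the second being the image
of the first under the `a`-th power, cuts that cycle into cycles of lengths `a` and `b`. -/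
theorem cycleType_swap_pow_mul (h : Perm X) (x : X) {a b : ℕ} (ha : 0 < a) (hb : 0 < b)
    (hc : (h.cycleOf x).support.card = a + b) :
    (swap x ((h ^ a) x) * h).cycleType + {a + b} =
      h.cycleType + Multiset.filter (2 ≤ ·) {a, b} := by
  have hx : x ∈ h.support := by
    by_contra hx
    rw [notMem_support, ← cycleOf_eq_one_iff] at hx
    simp [hx] at hc
    lia
  set L := toList h x with hL
  have hlen : L.length = a + b := by rw [hL, length_toList, hc]
  have hnd : L.Nodup := nodup_toList h x
  have hsplit : L.take a ++ L.drop a = L := List.take_append_drop a L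
  have htake : L.take a = x :: (L.take a).tail := by
    rw [← List.cons_head_tail (l := L.take a) (by
      rw [← List.length_pos_iff, List.length_take]; lia)]
    simp [List.head_eq_getElem, hL, getElem_toList]
  have hdrop : L.drop a = (h ^ a) x :: (L.drop a).tail := by
    rw [← List.cons_head_tail (l := L.drop a) (by
      rw [← List.length_pos_iff, List.length_drop]; lia)]
    simp [List.head_eq_getElem, hL, getElem_toList]
  set c := h.cycleOf x
  have hform : L.formPerm = c := formPerm_toList h x
  have hmul : swap x ((h ^ a) x) * c = (L.take a).formPerm * (L.drop a).formPerm := by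
    have h1 := List.formPerm_cons_append_cons (x := x) (y := (h ^ a) x)
      (l₁ := (L.take a).tail) (l₂ := (L.drop a).tail) (by rwa [← htake, ← hdrop, hsplit])
    rw [← htake, ← hdrop, hsplit, hform] at h1
    rw [h1, ← mul_assoc, swap_mul_self, one_mul]
  have hLs : L.toFinset = c.support := by
    rw [← hform, List.support_formPerm_of_nodup L hnd]
    intro y
    exact toList_ne_singleton h x y
  have hdisj : Disjoint (L.take a).formPerm (L.drop a).formPerm := by
    rw [disjoint_iff_disjoint_support, Finset.disjoint_left]
    intro z h1 h2
    have h1' := List.support_formPerm_le _ h1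
    have h2' := List.support_formPerm_le _ h2
    rw [← hsplit] at hnd
    exact (List.nodup_append.1 hnd).2.2 z (by simpa using h1') z (by simpa using h2') rfl
  have hmem : c ∈ h.cycleFactorsFinset := cycleOf_mem_cycleFactorsFinset_iff.2 hx
  have hcd := disjoint_mul_inv_of_mem_cycleFactorsFinset hmem
  have hcyc : c.cycleType = {a + b} := by
    rw [(isCycle_cycleOf h (mem_support.1 hx)).cycleType, hc]
  have hcomm : c * (h * c⁻¹) = h := by
    rw [← hcd.commute.eq, inv_mul_cancel_right]
  have hd2 : Disjoint (swap x ((h ^ a) x) * c) (h * c⁻¹) := by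
    rw [disjoint_iff_disjoint_support] at hcd ⊢
    refine hcd.symm.mono_left ?_
    rw [hmul]
    refine (support_mul_le _ _).trans ?_
    rw [← hLs]
    refine sup_le ?_ ?_
    · intro z hz
      have := List.support_formPerm_le _ hz
      exact List.mem_toFinset.2 (List.mem_of_mem_take (List.mem_toFinset.1 this))
    · intro z hz
      have := List.support_formPerm_le _ hz
      exact List.mem_toFinset.2 (List.mem_of_mem_drop (List.mem_toFinset.1 this))
  have hh : h.cycleType = {a + b} + (h * c⁻¹).cycleType := by
    rw [← hcyc, ← hcd.symm.cycleType_mul, hcomm]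
  have hg : (swap x ((h ^ a) x) * h).cycleType =
      Multiset.filter (2 ≤ ·) {a, b} + (h * c⁻¹).cycleType := by
    have hprod : swap x ((h ^ a) x) * h = swap x ((h ^ a) x) * c * (h * c⁻¹) := by
      rw [mul_assoc, hcomm]
    rw [hprod, hd2.cycleType_mul, hmul, hdisj.cycleType_mul,
      (hnd.sublist (List.take_sublist a L)).cycleType_formPerm,
      (hnd.sublist (List.drop_sublist a L)).cycleType_formPerm, ← Multiset.filter_add,
      List.length_take, List.length_drop, hlen]
    simp
  rw [hg, hh]
  abel

/-- Multiplying by the transposition of two points of distinct cycles merges these cycles. -/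
theorem sameCycle_swap_mul_of_not_sameCycle_s6 {h : Perm X} {x y : X} (hxy : ¬ h.SameCycle x y) :
    (swap x y * h).SameCycle x y := by
  have hex : ∃ k, 0 < k ∧ (h ^ k) x = x :=
    ⟨orderOf h, orderOf_pos h, by simp [pow_orderOf_eq_one]⟩
  classical
  obtain ⟨hk, hkx⟩ := Nat.find_spec hex
  have hmin : ∀ m < Nat.find hex, ¬ (0 < m ∧ (h ^ m) x = x) := fun m ↦ Nat.find_min hex
  generalize Nat.find hex = k at hk hkx hmin
  have key : ∀ m < k, ((swap x y * h) ^ m) x = (h ^ m) x := by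
    intro m
    induction m with
    | zero => simp
    | succ m ih =>
      intro hm
      rw [pow_succ', mul_apply, ih (by lia), mul_apply, ← mul_apply h, ← pow_succ']
      refine swap_apply_of_ne_of_ne ?_ ?_
      · exact fun h0 ↦ hmin _ hm ⟨by lia, h0⟩
      · exact fun h0 ↦ hxy ⟨(m + 1 : ℕ), by rwa [zpow_natCast]⟩
  refine ⟨(k : ℕ), ?_⟩
  obtain ⟨m, rfl⟩ := Nat.exists_eq_succ_of_ne_zero hk.ne'
  rw [zpow_natCast, pow_succ', mul_apply, key m (by lia), mul_apply, ← mul_apply h,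
    ← pow_succ', hkx, swap_apply_left]

theorem SameCycle.exists_pow_eq_and_card {h : Perm X} {x y : X} (hs : h.SameCycle x y)
    (hne : x ≠ y) :
    ∃ a b, 0 < a ∧ 0 < b ∧ (h.cycleOf x).support.card = a + b ∧ (h ^ a) x = y := by
  have hx : x ∈ h.support := by
    rw [mem_support]
    exact fun h0 ↦ hne (hs.eq_of_left h0)
  obtain ⟨a, ha, hay⟩ := hs.exists_pow_eq_of_mem_support hx
  refine ⟨a, (h.cycleOf x).support.card - a, Nat.pos_of_ne_zero ?_, by lia, by lia, hay⟩
  rintro rfl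
  exact hne (by simpa using hay)

theorem card_filter_card_support_cycleOf (h : Perm X) {n : ℕ} (hn : n ≠ 0) :
    (Finset.univ.filter fun x ↦ (h.cycleOf x).support.card = n).card =
      n * h.cycleType.count n := by
  have hcount : h.cycleType.count n =
      (h.cycleFactorsFinset.filter fun c ↦ c.support.card = n).card := by
    rw [cycleType_def, Multiset.count_map, Finset.card_def, Finset.filter_val]
    simp only [Function.comp_apply, eq_comm]
  rw [hcount, Finset.card_eq_sum_card_fiberwise (f := h.cycleOf)
    (t := h.cycleFactorsFinset.filter fun c ↦ c.support.card = n), mul_comm, ← smul_eq_mul,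
    ← Finset.sum_const]
  · refine Finset.sum_congr rfl fun c hc ↦ ?_
    rw [Finset.mem_filter] at hc
    rw [← hc.2]
    congr 1
    ext x
    simp only [Finset.mem_filter, Finset.mem_univ, true_and]
    constructor
    · rintro ⟨h1, rfl⟩
      rw [mem_support_cycleOf_iff, ← cycleOf_mem_cycleFactorsFinset_iff]
      exact ⟨.rfl, hc.1⟩
    · intro hx
      have := cycle_is_cycleOf hx hc.1
      exact ⟨by rw [← this], this.symm⟩
  · intro x hx
    simp only [Finset.coe_filter, Finset.mem_univ, true_and, Set.mem_ofPred_eq] at hx ⊢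
    refine ⟨?_, hx⟩
    rw [cycleOf_mem_cycleFactorsFinset_iff]
    by_contra h0
    rw [notMem_support, ← cycleOf_eq_one_iff] at h0
    simp [h0] at hx
    exact hn hx.symm

theorem pow_card_support_cycleOf_apply (h : Perm X) (x : X) :
    (h ^ (h.cycleOf x).support.card) x = x := by
  rw [← pow_mod_card_support_cycleOf_self_apply]
  simp

end Equiv.Perm

/-- If adding the parts `≥ 2` of `{a, b}` in place of `a + b` amounts to adding `i ≠ j` in
place of `i + j`, then `{a, b} = {i, j}`. -/
theorem Multiset.eq_and_eq_or_of_cut {μ : Multiset ℕ} {i j a b : ℕ} (hi : 2 ≤ i) (hj : 2 ≤ j)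
    (he : μ.erase (i + j) + {i, j} + {a + b} = μ + Multiset.filter (2 ≤ ·) {a, b}) :
    i + j ∈ μ ∧ (a = i ∧ b = j ∨ a = j ∧ b = i) := by
  by_cases hm : i + j ∈ μ
  · refine ⟨hm, ?_⟩
    obtain ⟨e, rfl⟩ := Multiset.exists_cons_of_mem hm
    rw [Multiset.erase_cons_head, ← Multiset.singleton_add, add_comm {i + j} e, add_assoc,
      add_assoc] at he
    replace he := add_left_cancel he
    have h1 : i + j = a + b := by
      have : i + j ∈ ({i, j} + {a + b} : Multiset ℕ) := by rw [he]; simp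
      simp at this
      lia
    rw [h1, add_comm] at he
    replace he := add_left_cancel he
    have h2 : i ∈ Multiset.filter (2 ≤ ·) {a, b} := by rw [← he]; simp
    have h3 := Multiset.mem_of_mem_filter h2
    simp at h3
    lia
  · rw [Multiset.erase_of_notMem hm, add_assoc] at he
    have h1 := congrArg Multiset.sum (add_left_cancel he)
    have h2 := congrArg Multiset.sum (Multiset.filter_add_not (2 ≤ ·) ({a, b} : Multiset ℕ))
    simp only [Multiset.sum_add, Multiset.sum_pair, Multiset.sum_singleton] at h1 h2
    lia

theorem Multiset.erase_add_pair_ne_of_merge {μ F : Multiset ℕ} {i j n : ℕ} (hi : 2 ≤ i)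
    (hj : 2 ≤ j) : μ + {n} ≠ μ.erase (i + j) + {i, j} + F := by
  intro he
  by_cases hm : i + j ∈ μ
  · obtain ⟨e, rfl⟩ := Multiset.exists_cons_of_mem hm
    rw [Multiset.erase_cons_head, ← Multiset.singleton_add, add_comm {i + j} e, add_assoc,
      add_assoc] at he
    replace he := add_left_cancel he
    have h1 := congrArg Multiset.card he
    simp at h1
    have h2 : i + j ∈ ({i, j} + F : Multiset ℕ) := by rw [← he]; simp
    simp [h1] at h2
    lia
  · rw [Multiset.erase_of_notMem hm, add_assoc] at he
    have h1 := congrArg Multiset.card (add_left_cancel he)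
    simp at h1

namespace Equiv.Perm

theorem cycleType_swap_pow_mul_eq_erase_add (h : Perm X) (x : X) {i j : ℕ} (hi : 2 ≤ i)
    (hj : 2 ≤ j) (hc : (h.cycleOf x).support.card = i + j) :
    (swap x ((h ^ i) x) * h).cycleType = h.cycleType.erase (i + j) + {i, j} := by
  have hx : h x ≠ x := by
    intro h0
    rw [← cycleOf_eq_one_iff] at h0
    simp [h0] at hc
    lia
  have hm : i + j ∈ h.cycleType := by
    rw [cycleType_def, Multiset.mem_map]
    exact ⟨h.cycleOf x, cycleOf_mem_cycleFactorsFinset_iff.2 (mem_support.2 hx), hc⟩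
  have key := cycleType_swap_pow_mul h x (by lia) (by lia) hc
  have hF : Multiset.filter (2 ≤ ·) ({i, j} : Multiset ℕ) = {i, j} :=
    Multiset.filter_eq_self.2 (by simp [hi, hj])
  obtain ⟨e, he⟩ := Multiset.exists_cons_of_mem hm
  rw [hF, he, ← Multiset.singleton_add, add_assoc, add_comm] at key
  rw [add_left_cancel key, he, Multiset.erase_cons_head]

theorem injOn_swap_pow_apply (h : Perm X) {i j : ℕ} (hi : 0 < i) (hj : 0 < j) (hij : i ≠ j) :
    Set.InjOn (fun x ↦ swap x ((h ^ i) x)) {x | (h.cycleOf x).support.card = i + j} := by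
  have hpow : ∀ x, (h.cycleOf x).support.card = i + j → ∀ m, (h ^ m) x = x → i + j ∣ m := by
    intro x hc m hm
    have hx : h x ≠ x := by
      intro h0
      rw [← cycleOf_eq_one_iff] at h0
      simp [h0] at hc
      lia
    have h1 := (h.isCycleOn_support_cycleOf x).pow_apply_eq
      (mem_support_cycleOf_iff.2 ⟨.rfl, mem_support.2 hx⟩) (n := m)
    rw [hc] at h1
    exact h1.1 hm
  intro x hx y hy hxy
  by_contra hne
  simp only at hxy
  have hx1 : (h ^ i) x ≠ x := fun h0 ↦ absurd (Nat.le_of_dvd hi (hpow x hx i h0)) (by lia)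
  have h1 : swap y ((h ^ i) y) x = (h ^ i) x := by rw [← hxy, swap_apply_left]
  have h2 : x = (h ^ i) y := by
    by_contra h0
    rw [swap_apply_of_ne_of_ne hne h0] at h1
    exact hx1 h1.symm
  rw [h2, swap_apply_right] at h1
  have h3 : (h ^ (i + i)) y = y := by rw [pow_add, mul_apply, ← h1]
  obtain ⟨q, hq⟩ := hpow y hy _ h3
  have hq0 : q ≠ 0 := by rintro rfl; lia
  have hq2 : q < 2 := by
    by_contra hq2
    have := Nat.mul_le_mul_left (i + j) (not_lt.1 hq2)
    lia
  obtain rfl : q = 1 := by lia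
  lia

end Equiv.Perm

end


/-- Let `h` be a permutation of a finite set `X` with cycle type `μ`, and let `i, j ≥ 2`
with `i ≠ j`.  The number of transpositions `τ` of `X` such that the cycle type of `τ·h`
equals the multiset obtained from `μ` by removing one copy of `i + j` and adding one copy
of `i` and one copy of `j` is exactly `(i + j) · m_{i+j}(μ)`, where `m_k(μ)` is the
multiplicity of `k` in `μ`. -/
theorem card_cutting_transpositions {X : Type*} [Fintype X] [DecidableEq X]
    (h : Equiv.Perm X) (i j : ℕ) (hi : 2 ≤ i) (hj : 2 ≤ j) (hij : i ≠ j) :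
    {τ : Equiv.Perm X | τ.IsSwap ∧
        (τ * h).cycleType = h.cycleType.erase (i + j) + {i, j}}.ncard
      = (i + j) * h.cycleType.count (i + j) := by
  have hset : {τ : Equiv.Perm X | τ.IsSwap ∧
      (τ * h).cycleType = h.cycleType.erase (i + j) + {i, j}} =
      (fun x ↦ swap x ((h ^ i) x)) '' {x | (h.cycleOf x).support.card = i + j} := by
    ext τ
    constructor
    · rintro ⟨⟨x, y, hne, rfl⟩, hτ⟩
      by_cases hs : h.SameCycle x y
      · obtain ⟨a, b, ha, hb, hc, rfl⟩ := hs.exists_pow_eq_and_card hne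
        have key := cycleType_swap_pow_mul h x ha hb hc
        rw [hτ] at key
        obtain ⟨-, ⟨rfl, rfl⟩ | ⟨rfl, rfl⟩⟩ := Multiset.eq_and_eq_or_of_cut hi hj key
        · exact ⟨x, hc, rfl⟩
        · refine ⟨(h ^ a) x, ?_, ?_⟩
          · rw [Set.mem_ofPred_eq, ← hs.cycleOf_eq, hc, add_comm]
          · have := pow_card_support_cycleOf_apply h x
            rw [hc, add_comm, pow_add, mul_apply] at this
            simp only [this]
            exact swap_comm _ _
      · have hs' := sameCycle_swap_mul_of_not_sameCycle_s6 hs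
        obtain ⟨a, b, ha, hb, hc, hy⟩ := hs'.exists_pow_eq_and_card hne
        have key := cycleType_swap_pow_mul _ x ha hb hc
        rw [hy, ← mul_assoc, swap_mul_self, one_mul, hτ] at key
        exact absurd key (Multiset.erase_add_pair_ne_of_merge hi hj)
    · rintro ⟨x, hx, rfl⟩
      have hct := cycleType_swap_pow_mul_eq_erase_add h x hi hj hx
      refine ⟨⟨x, (h ^ i) x, fun h0 ↦ ?_, rfl⟩, hct⟩
      rw [← h0, swap_self, ← Perm.one_def, one_mul] at hct
      exact Multiset.erase_add_pair_ne_of_merge hi hj (congrArg (· + {2}) hct)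
  rw [hset, (injOn_swap_pow_apply h (by lia) (by lia) hij).ncard_image,
    ← card_filter_card_support_cycleOf h (by lia : i + j ≠ 0), ← Set.ncard_coe_finset]
  simp
end

section
/- Let h be a permutation of a finite set X with cycle type μ, and let i, j be integers with i, j ≥ 2 and i ≠ j. Then the number of transpositions τ of X such that the cycle type of τ·h equals the multiset obtained from μ by removing one copy of i and one copy of j and adding one copy of i+j is exactly i·j·m_i(μ)·m_j(μ). -/
open Finset in
/-- The size of the orbit of `x` under `h`, fixed points having size `1`. -/
def Equiv.Perm.orbitSize {X : Type*} [Fintype X] [DecidableEq X] (h : Equiv.Perm X) (x : X) : ℕ :=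
  #{y | h.SameCycle x y}

namespace Equiv.Perm

open _root_.Finset

variable {X : Type*}

theorem SameCycle.of_forall_rel {h : Perm X} {r : X → X → Prop} (hr : Equivalence r)
    (hstep : ∀ u, r u (h u)) {u v : X} (huv : h.SameCycle u v) : r u v := by
  obtain ⟨n, rfl⟩ := huv
  induction n with
  | zero => exact hr.refl u
  | succ n ih =>
    rw [add_comm, zpow_add, zpow_one, mul_apply]
    exact hr.trans ih (hstep _)
  | pred n ih =>
    have := hstep ((h ^ (-(n : ℤ) - 1)) u)
    rw [← mul_apply, ← zpow_one_add, add_sub_cancel] at this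
    exact hr.trans ih (hr.symm this)

variable [DecidableEq X]

theorem rel_swap_apply {r : X → X → Prop} (hr : Equivalence r) {x y : X} (hxy : r x y) (z : X) :
    r z (swap x y z) := by
  by_cases hx : z = x
  · subst hx; simpa using hxy
  · by_cases hy : z = y
    · subst hy; simpa using hr.symm hxy
    · rw [swap_apply_of_ne_of_ne hx hy]; exact hr.refl z

theorem SameCycle.swap_mul_s7 {h : Perm X} {x y u v : X} (hxy : (swap x y * h).SameCycle x y)
    (huv : h.SameCycle u v) : (swap x y * h).SameCycle u v := by
  refine huv.of_forall_rel (SameCycle.equivalence _) fun w => ?_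
  have h₁ : (swap x y * h).SameCycle w (swap x y (h w)) := ⟨1, by simp⟩
  exact h₁.trans (rel_swap_apply (SameCycle.equivalence _) hxy (h w)).symm

theorem sameCycle_swap_mul_self [Finite X] {h : Perm X} {x y : X} (hxy : ¬ h.SameCycle x y) :
    (swap x y * h).SameCycle x y := by
  have key : ∀ n : ℕ, (swap x y * h).SameCycle x ((h ^ n) x) := by
    intro n
    induction n with
    | zero => exact .refl _ x
    | succ n ih =>
      rw [pow_succ', mul_apply]
      by_cases hx : h ((h ^ n) x) = x
      · rw [hx]
      · have hy : h ((h ^ n) x) ≠ y := fun hy => hxy ⟨(n + 1 : ℕ), by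
          rw [zpow_natCast, pow_succ', mul_apply, hy]⟩
        exact ih.trans ⟨1, by simp [swap_apply_of_ne_of_ne hx hy]⟩
  obtain ⟨n, hn⟩ := SameCycle.exists_nat_pow_eq (f := h) (x := x) (y := h⁻¹ x) ⟨-1, by simp⟩
  have h₁ := key n
  rw [hn] at h₁
  exact h₁.trans ⟨1, by simp⟩

theorem sameCycle_swap_mul_iff [Finite X] {h : Perm X} {x y : X} (hxy : ¬ h.SameCycle x y)
    {u v : X} :
    (swap x y * h).SameCycle u v ↔ h.SameCycle u v ∨
      ((h.SameCycle x u ∨ h.SameCycle y u) ∧ (h.SameCycle x v ∨ h.SameCycle y v)) := by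
  have hg := sameCycle_swap_mul_self hxy
  constructor
  · intro huv
    have hr : Equivalence fun u v => h.SameCycle u v ∨
        ((h.SameCycle x u ∨ h.SameCycle y u) ∧ (h.SameCycle x v ∨ h.SameCycle y v)) := by
      refine ⟨fun u => .inl (.refl h u), ?_, ?_⟩
      · rintro u v (huv | huv)
        · exact .inl huv.symm
        · exact .inr huv.symm
      · rintro u v w (huv | ⟨hu, hv⟩) (hvw | ⟨hv', hw⟩)
        · exact .inl (huv.trans hvw)
        · exact .inr ⟨hv'.imp (·.trans huv.symm) (·.trans huv.symm), hw⟩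
        · exact .inr ⟨hu, hv.imp (·.trans hvw) (·.trans hvw)⟩
        · exact .inr ⟨hu, hw⟩
    refine huv.of_forall_rel hr fun w => ?_
    exact hr.trans (.inl ⟨1, by simp⟩)
      (rel_swap_apply hr (.inr ⟨.inl (.refl h x), .inr (.refl h y)⟩) (h w))
  · rintro (huv | ⟨hu, hv⟩)
    · exact hg.swap_mul_s7 huv
    · have aux : ∀ w, h.SameCycle x w ∨ h.SameCycle y w → (swap x y * h).SameCycle x w := by
        rintro w (hw | hw)
        · exact hg.swap_mul_s7 hw
        · exact hg.trans (hg.swap_mul_s7 hw)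
      exact (aux u hu).symm.trans (aux v hv)

variable [Fintype X]

theorem orbitSize_pos (h : Perm X) (x : X) : 0 < h.orbitSize x :=
  card_pos.mpr ⟨x, by simpa using SameCycle.refl h x⟩

theorem SameCycle.orbitSize_eq {h : Perm X} {x y : X} (hxy : h.SameCycle x y) :
    h.orbitSize x = h.orbitSize y := by
  unfold orbitSize
  congr 1
  ext z
  simpa using ⟨hxy.symm.trans, hxy.trans⟩

theorem card_orbitSize_eq (h : Perm X) {k : ℕ} (hk : 2 ≤ k) :
    #{x | h.orbitSize x = k} = k * h.cycleType.count k := by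
  have hsupp : ∀ x, h x ≠ x → (h.cycleOf x).support = ({y | h.SameCycle x y} : Finset X) := by
    intro x hx
    ext y
    simp [mem_support_cycleOf_iff' hx]
  have hfix : ∀ x, h.orbitSize x = k → h x ≠ x := by
    intro x hx hx'
    have : ({y | h.SameCycle x y} : Finset X) = {x} := by
      ext y
      simp only [mem_filter_univ, mem_singleton]
      exact ⟨fun hy => (hy.eq_of_left hx').symm, fun hy => hy ▸ .refl h x⟩
    rw [orbitSize, this, card_singleton] at hx
    omega
  have hcount : h.cycleType.count k = #{c ∈ h.cycleFactorsFinset | #c.support = k} := by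
    simp_rw [cycleType_def, Multiset.count_map, eq_comm (a := k)]
    rfl
  rw [hcount, mul_comm, card_eq_sum_card_fiberwise (f := h.cycleOf)
    (t := {c ∈ h.cycleFactorsFinset | #c.support = k})]
  · refine sum_const_nat fun c hc => ?_
    rw [mem_filter] at hc
    rw [← hc.2]
    congr 1
    ext x
    rw [mem_filter, mem_filter_univ, eq_comm (a := h.cycleOf x),
      eq_cycleOf_of_mem_cycleFactorsFinset_iff h c hc.1]
    refine ⟨fun hx => hx.2, fun hx => ⟨?_, hx⟩⟩
    have hcx := (eq_cycleOf_of_mem_cycleFactorsFinset_iff h c hc.1 x).mpr hx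
    rw [hcx, hsupp x (mem_support.mp (mem_cycleFactorsFinset_support_le hc.1 hx))]
    rfl
  · intro x hx
    have hx : h.orbitSize x = k := by simpa using hx
    simp only [coe_filter, Set.mem_ofPred_eq, cycleOf_mem_cycleFactorsFinset_iff, mem_support]
    exact ⟨hfix x hx, by rw [hsupp x (hfix x hx)]; exact hx⟩

theorem orbitSize_swap_mul {h : Perm X} {x y : X} (hxy : ¬ h.SameCycle x y) (u : X) :
    (swap x y * h).orbitSize u = if h.SameCycle x u ∨ h.SameCycle y u
      then h.orbitSize x + h.orbitSize y else h.orbitSize u := by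
  split_ifs with hu
  · rw [orbitSize, orbitSize, orbitSize, ← card_union_of_disjoint]
    · congr 1
      ext v
      simp only [mem_filter_univ, mem_union, sameCycle_swap_mul_iff hxy, hu, true_and]
      refine or_iff_right_of_imp fun huv => ?_
      exact hu.imp (·.trans huv) (·.trans huv)
    · rw [disjoint_filter]
      exact fun v _ hv hv' => hxy (hv.trans hv'.symm)
  · simp [orbitSize, sameCycle_swap_mul_iff hxy, hu]

theorem card_orbitSize_swap_mul {h : Perm X} {x y : X} (hxy : ¬ h.SameCycle x y) (k : ℕ) :
    #{u | (swap x y * h).orbitSize u = k} + (if k = h.orbitSize x then k else 0)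
        + (if k = h.orbitSize y then k else 0)
      = #{u | h.orbitSize u = k}
        + if k = h.orbitSize x + h.orbitSize y then k else 0 := by
  set A : Finset X := {u | h.SameCycle x u} with hA
  set B : Finset X := {u | h.SameCycle y u} with hB
  have hAB : _root_.Disjoint A B := by
    rw [disjoint_filter]
    exact fun v _ hv hv' => hxy (hv.trans hv'.symm)
  have hsplit : ∀ f : X → ℕ, #{u | f u = k} = ∑ u ∈ A, (if f u = k then 1 else 0)
      + ∑ u ∈ B, (if f u = k then 1 else 0) + ∑ u ∈ (A ∪ B)ᶜ, (if f u = k then 1 else 0) := by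
    intro f
    rw [card_filter, ← sum_add_sum_compl (A ∪ B), sum_union hAB]
  have hconst : ∀ (S : Finset X) (f : X → ℕ) (c : ℕ), (∀ u ∈ S, f u = c) →
      ∑ u ∈ S, (if f u = k then 1 else 0) = if k = c then #S else 0 := by
    intro S f c hc
    rw [sum_congr rfl fun u hu => by rw [hc u hu]]
    simp [eq_comm]
  have hcompl : ∑ u ∈ (A ∪ B)ᶜ, (if (swap x y * h).orbitSize u = k then 1 else 0)
      = ∑ u ∈ (A ∪ B)ᶜ, (if h.orbitSize u = k then 1 else 0) := by
    refine sum_congr rfl fun u hu => ?_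
    have hu' : ¬ (h.SameCycle x u ∨ h.SameCycle y u) := by simpa [hA, hB] using hu
    rw [orbitSize_swap_mul hxy, if_neg hu']
  have hcA : #A = h.orbitSize x := rfl
  have hcB : #B = h.orbitSize y := rfl
  rw [hsplit, hsplit, hcompl,
    hconst A _ (h.orbitSize x + h.orbitSize y) (fun u hu => by
      rw [orbitSize_swap_mul hxy, if_pos (.inl (by simpa [hA] using hu))]),
    hconst B _ (h.orbitSize x + h.orbitSize y) (fun u hu => by
      rw [orbitSize_swap_mul hxy, if_pos (.inr (by simpa [hB] using hu))]),
    hconst A h.orbitSize (h.orbitSize x) (fun u hu =>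
      (SameCycle.orbitSize_eq (by simpa [hA] using hu)).symm),
    hconst B h.orbitSize (h.orbitSize y) (fun u hu =>
      (SameCycle.orbitSize_eq (by simpa [hB] using hu)).symm), hcA, hcB]
  split_ifs <;> omega

theorem count_cycleType_swap_mul {h : Perm X} {x y : X} (hxy : ¬ h.SameCycle x y) {k : ℕ}
    (hk : 2 ≤ k) :
    (swap x y * h).cycleType.count k + (if k = h.orbitSize x then 1 else 0)
        + (if k = h.orbitSize y then 1 else 0)
      = h.cycleType.count k + if k = h.orbitSize x + h.orbitSize y then 1 else 0 := by
  have key := card_orbitSize_swap_mul hxy k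
  rw [card_orbitSize_eq _ hk, card_orbitSize_eq _ hk] at key
  refine Nat.eq_of_mul_eq_mul_left (by omega : 0 < k) ?_
  simpa only [mul_add, mul_ite, mul_one, mul_zero] using key

theorem count_cycleType_eq_of_sameCycle_iff {g h : Perm X}
    (hgh : ∀ u v, g.SameCycle u v ↔ h.SameCycle u v) {k : ℕ} (hk : 2 ≤ k) :
    g.cycleType.count k = h.cycleType.count k := by
  refine Nat.eq_of_mul_eq_mul_left (by omega : 0 < k) ?_
  rw [← card_orbitSize_eq _ hk, ← card_orbitSize_eq _ hk]
  have horbit : ∀ u, g.orbitSize u = h.orbitSize u := fun u => by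
    unfold orbitSize
    congr 1
    ext v
    simp [hgh]
  simp [horbit]

theorem cycleType_eq_iff_count {g : Perm X} {s : Multiset ℕ} (hs : ∀ n ∈ s, 2 ≤ n) :
    g.cycleType = s ↔ ∀ k, 2 ≤ k → g.cycleType.count k = s.count k := by
  refine ⟨fun hg k _ => hg ▸ rfl, fun hg => Multiset.ext' fun k => ?_⟩
  by_cases hk : 2 ≤ k
  · exact hg k hk
  · rw [Multiset.count_eq_zero_of_notMem fun hk' => hk (two_le_of_mem_cycleType hk'),
      Multiset.count_eq_zero_of_notMem fun hk' => hk (hs k hk')]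

theorem cycleType_swap_mul_eq_join_iff (h : Perm X) {i j : ℕ} (hi : 2 ≤ i) (hj : 2 ≤ j)
    (hij : i ≠ j) (x y : X) :
    (swap x y * h).cycleType = (h.cycleType.erase i).erase j + {i + j} ↔
      (h.orbitSize x = i ∧ h.orbitSize y = j) ∨ (h.orbitSize x = j ∧ h.orbitSize y = i) := by
  have hs : ∀ n ∈ (h.cycleType.erase i).erase j + {i + j}, 2 ≤ n := by
    intro n hn
    rcases Multiset.mem_add.mp hn with hn | hn
    · exact two_le_of_mem_cycleType (Multiset.mem_of_mem_erase (Multiset.mem_of_mem_erase hn))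
    · rw [Multiset.mem_singleton.mp hn]; omega
  have hcount : ∀ k, ((h.cycleType.erase i).erase j + {i + j}).count k =
      h.cycleType.count k - (if k = i then 1 else 0) - (if k = j then 1 else 0)
        + if k = i + j then 1 else 0 := by
    intro k
    have herase : ∀ (s : Multiset ℕ) (a : ℕ),
        (s.erase a).count k = s.count k - if k = a then 1 else 0 := by
      intro s a
      split_ifs with hka
      · rw [hka, Multiset.count_erase_self]
      · rw [Multiset.count_erase_of_ne hka, Nat.sub_zero]
    rw [Multiset.count_add, Multiset.count_singleton, herase, herase]
  rw [cycleType_eq_iff_count hs]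
  simp only [hcount]
  have hx := h.orbitSize_pos x
  have hy := h.orbitSize_pos y
  constructor
  · intro hk
    by_cases hxy : h.SameCycle x y
    · exfalso
      by_cases hg : (swap x y * h).SameCycle x y
      · have hsame : ∀ u v, (swap x y * h).SameCycle u v ↔ h.SameCycle u v := fun u v =>
          ⟨fun huv => by
            have := SameCycle.swap_mul_s7 (h := swap x y * h) (x := x) (y := y)
              (by simpa using hxy) huv
            simpa using this, hg.swap_mul_s7⟩
        have h₁ := hk (i + j) (by omega)
        rw [count_cycleType_eq_of_sameCycle_iff hsame (by omega)] at h₁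
        simp at h₁
        grind
      · have hJ := fun k => count_cycleType_swap_mul hg (k := k)
        simp only [swap_mul_self_mul] at hJ
        have hgx := (swap x y * h).orbitSize_pos x
        have hgy := (swap x y * h).orbitSize_pos y
        have h₁ := hJ (i + j) (by omega)
        have h₂ := hk (i + j) (by omega)
        have h₃ := hJ _ (by omega : 2 ≤ (swap x y * h).orbitSize x + (swap x y * h).orbitSize y)
        have h₄ := hk _ (by omega : 2 ≤ (swap x y * h).orbitSize x + (swap x y * h).orbitSize y)
        grind
    · have hJ := fun k => count_cycleType_swap_mul hxy (k := k)
      have hsum : h.orbitSize x + h.orbitSize y = i + j := by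
        have h₁ := hJ (i + j) (by omega)
        have h₂ := hk (i + j) (by omega)
        split_ifs at h₁ h₂ <;> omega
      by_contra hne
      have h₁ : 2 ≤ h.orbitSize x ∨ 2 ≤ h.orbitSize y := by omega
      rcases h₁ with hsize | hsize
      all_goals
        have h₂ := hJ _ hsize
        have h₃ := hk _ hsize
        split_ifs at h₂ h₃ <;> omega
  · intro hor k hk
    have hxy : ¬ h.SameCycle x y := fun hxy => by
      have := hxy.orbitSize_eq
      omega
    have hJ := count_cycleType_swap_mul hxy hk
    grind

end Equiv.Perm

open Equiv Equiv.Perm Finset in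
/-- Let `h` be a permutation of a finite set `X` with cycle type `μ`, and let `i, j ≥ 2`
with `i ≠ j`.  The number of transpositions `τ` of `X` such that the cycle type of `τ·h`
equals the multiset obtained from `μ` by removing one copy of `i` and one copy of `j` and
adding one copy of `i + j` is exactly `i · j · m_i(μ) · m_j(μ)`, where `m_k(μ)` is the
multiplicity of `k` in `μ`. -/
theorem card_joining_transpositions {X : Type*} [Fintype X] [DecidableEq X]
    (h : Equiv.Perm X) (i j : ℕ) (hi : 2 ≤ i) (hj : 2 ≤ j) (hij : i ≠ j) :
    {τ : Equiv.Perm X | τ.IsSwap ∧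
        (τ * h).cycleType = (h.cycleType.erase i).erase j + {i + j}}.ncard
      = i * j * h.cycleType.count i * h.cycleType.count j := by
  set A : Finset X := {x | h.orbitSize x = i} with hA
  set B : Finset X := {x | h.orbitSize x = j} with hB
  have hne : ∀ {x y}, x ∈ A → y ∈ B → x ≠ y := by
    rintro x _ hx hy rfl
    simp only [hA, hB, mem_filter_univ] at hx hy
    omega
  have himage : {τ : Equiv.Perm X | τ.IsSwap ∧
      (τ * h).cycleType = (h.cycleType.erase i).erase j + {i + j}}
      = ((A ×ˢ B).image fun p : X × X => swap p.1 p.2 : Finset (Equiv.Perm X)) := by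
    ext τ
    simp only [Set.mem_ofPred_eq, coe_image, Set.mem_image, mem_coe, mem_product, Prod.exists]
    constructor
    · rintro ⟨⟨x, y, -, rfl⟩, hτ⟩
      rcases (cycleType_swap_mul_eq_join_iff h hi hj hij x y).mp hτ with hxy | hxy
      · exact ⟨x, y, by simpa [hA, hB] using hxy, rfl⟩
      · exact ⟨y, x, by simpa [hA, hB] using hxy.symm, swap_comm y x⟩
    · rintro ⟨x, y, ⟨hx, hy⟩, rfl⟩
      refine ⟨⟨x, y, hne hx hy, rfl⟩, (cycleType_swap_mul_eq_join_iff h hi hj hij x y).mpr ?_⟩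
      exact .inl ⟨by simpa [hA] using hx, by simpa [hB] using hy⟩
  rw [himage, Set.ncard_coe_finset, card_image_of_injOn, card_product,
    card_orbitSize_eq h hi, card_orbitSize_eq h hj]
  · ring
  · rintro ⟨x, y⟩ hp ⟨x', y'⟩ hp' heq
    simp only [coe_product, Set.mem_prod, mem_coe] at hp hp' heq
    have h₁ : ({x, y} : Finset X) = {x', y'} := by
      rw [← support_swap (hne hp.1 hp.2), ← support_swap (hne hp'.1 hp'.2), heq]
    have hx : x = x' ∨ x = y' := by
      simpa using (h₁ ▸ mem_insert_self x {y} : x ∈ ({x', y'} : Finset X))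
    have hy : y = x' ∨ y = y' := by
      simpa using (h₁ ▸ mem_insert_of_mem (mem_singleton_self y) : y ∈ ({x', y'} : Finset X))
    have hx := hx.resolve_right (hne hp.1 hp'.2)
    have hy := hy.resolve_left (hne hp'.1 hp.2).symm
    rw [hx, hy]
end

section
/- Let ρ be a partition. For each m ∈ ℕ, the number a_m of semistandard Young tableaux of shape ρ (with entries in the nonnegative integers) whose entries sum to m is finite, and in the ring of formal power series ℤ⟦q⟧ one has (∑_{m≥0} a_m q^m) · ∏_{x∈ρ} (1 − q^{h(x)}) = q^{n(ρ)}. (Equivalently, the specialization s_ρ(1, q, q², …) of the Schur function equals q^{n(ρ)} / ∏_{x∈ρ}(1 − q^{h(x)}).) -/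
/-- The hook length of a cell `c = (i, j)` (0-indexed) of a Young diagram `μ`:
for the 1-indexed cell `(a, b) = (i+1, j+1)` this is `(ρ_a − b) + (ρ'_b − a) + 1`,
i.e. `(rowLen i − (j+1)) + (colLen j − (i+1)) + 1`. -/
def YoungDiagram.hookLength (μ : YoungDiagram) (c : ℕ × ℕ) : ℕ :=
  (μ.rowLen c.1 - c.2) + (μ.colLen c.2 - c.1) - 1

/-- `n(ρ) = ∑_a (a − 1) ρ_a`, i.e. the sum over all cells of the (0-indexed) row index. -/
def YoungDiagram.nStat (μ : YoungDiagram) : ℕ :=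
  ∑ c ∈ μ.cells, c.1

namespace YoungDiagram

/-- The left neighbour of an entry of an array, with value `0` on the first column. -/
def leftEntry (P : ℕ → ℕ → ℕ) : ℕ → ℕ → ℕ
  | _, 0 => 0
  | i, j + 1 => P i j

/-- The upper neighbour of an entry of an array, with value `0` on the first row. -/
def upEntry (P : ℕ → ℕ → ℕ) : ℕ → ℕ → ℕ
  | 0, _ => 0
  | i + 1, j => P i j

/-- The larger of the left and upper neighbours of an entry. -/
def maxPred (P : ℕ → ℕ → ℕ) (i j : ℕ) : ℕ :=
  max (leftEntry P i j) (upEntry P i j)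

/-- The sum of the entries `P (i - 1) (j - 1)`, `P (i - 2) (j - 2)`, … on a diagonal. -/
def diagSum (P : ℕ → ℕ → ℕ) : ℕ → ℕ → ℕ
  | 0, _ => 0
  | _ + 1, 0 => 0
  | i + 1, j + 1 => P i j + diagSum P i j

/-- The sum of the entries `f a b` with `a < i` and `b < j`. -/
def rectSum (f : ℕ → ℕ → ℕ) (i j : ℕ) : ℕ :=
  ∑ a ∈ Finset.range i, ∑ b ∈ Finset.range j, f a b

/-- An array vanishing outside of a Young diagram. -/
def IsFilling (μ : YoungDiagram) (f : ℕ → ℕ → ℕ) : Prop :=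
  ∀ i j, (i, j) ∉ μ → f i j = 0

/-- An array whose entries in a Young diagram weakly increase along rows and columns. -/
def IsWeaklyIncreasing (μ : YoungDiagram) (P : ℕ → ℕ → ℕ) : Prop :=
  ∀ i j, (i, j) ∈ μ → leftEntry P i j ≤ P i j ∧ upEntry P i j ≤ P i j

/-- The positions outside of a Young diagram that lie on an axis or diagonally below a cell. -/
def IsOuterRim (μ : YoungDiagram) (i j : ℕ) : Prop :=
  (i, j) ∉ μ ∧ (i = 0 ∨ j = 0 ∨ (i - 1, j - 1) ∈ μ)

/-- Toggle the entries strictly north-west of `(p, q)` on its diagonal, and put `v` at `(p, q)`. -/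
def toggle (p q : ℕ) (P : ℕ → ℕ → ℕ) (v : ℕ) (i j : ℕ) : ℕ :=
  if i + q = j + p then
    if i < p then maxPred P i j + min (P i (j + 1)) (P (i + 1) j) - P i j
    else if i = p then v else P i j
  else P i j

theorem toggle_of_ne {p q i j : ℕ} (P : ℕ → ℕ → ℕ) (v : ℕ) (h : i + q ≠ j + p) :
    toggle p q P v i j = P i j := by
  simp [toggle, h]

theorem toggle_self (p q : ℕ) (P : ℕ → ℕ → ℕ) (v : ℕ) : toggle p q P v p q = v := by
  simp [toggle, add_comm]

theorem toggle_of_lt {p q i j : ℕ} (P : ℕ → ℕ → ℕ) (v : ℕ) (h : i + q = j + p) (hi : i < p) :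
    toggle p q P v i j = maxPred P i j + min (P i (j + 1)) (P (i + 1) j) - P i j := by
  simp [toggle, h, hi]

theorem toggle_of_gt {p q i j : ℕ} (P : ℕ → ℕ → ℕ) (v : ℕ) (hi : p < i) :
    toggle p q P v i j = P i j := by
  simp [toggle, hi.not_gt, hi.ne']

theorem leftEntry_toggle {p q i j : ℕ} (P : ℕ → ℕ → ℕ) (v : ℕ) (h : i + q = j + p) :
    leftEntry (toggle p q P v) i j = leftEntry P i j := by
  rcases j with _ | j
  · rfl
  · exact toggle_of_ne P v (by omega)

theorem upEntry_toggle {p q i j : ℕ} (P : ℕ → ℕ → ℕ) (v : ℕ) (h : i + q = j + p) :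
    upEntry (toggle p q P v) i j = upEntry P i j := by
  rcases i with _ | i
  · rfl
  · exact toggle_of_ne P v (by omega)

theorem maxPred_toggle {p q i j : ℕ} (P : ℕ → ℕ → ℕ) (v : ℕ) (h : i + q = j + p) :
    maxPred (toggle p q P v) i j = maxPred P i j := by
  simp only [maxPred, leftEntry_toggle P v h, upEntry_toggle P v h]

theorem diagSum_toggle_of_ne {p q : ℕ} (P : ℕ → ℕ → ℕ) (v : ℕ) {i j : ℕ} (h : i + q ≠ j + p) :
    diagSum (toggle p q P v) i j = diagSum P i j := by
  induction i generalizing j with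
  | zero => simp [diagSum]
  | succ i ih =>
    rcases j with _ | j
    · simp [diagSum]
    · have h' : i + q ≠ j + p := by omega
      simp only [diagSum, ih h', toggle_of_ne P v h']

theorem rectSum_succ_succ_add (f : ℕ → ℕ → ℕ) (i j : ℕ) :
    rectSum f (i + 1) (j + 1) + rectSum f i j
      = rectSum f (i + 1) j + rectSum f i (j + 1) + f i j := by
  simp only [rectSum, Finset.sum_range_succ]
  omega

theorem rectSum_succ_succ (f : ℕ → ℕ → ℕ) (i j : ℕ) :
    rectSum f (i + 1) (j + 1) = rectSum f i j
      + (∑ b ∈ Finset.range (j + 1), f i b + ∑ a ∈ Finset.range i, f a j) := by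
  simp only [rectSum, Finset.sum_range_succ, Finset.sum_add_distrib]
  omega

theorem rectSum_congr {f g : ℕ → ℕ → ℕ} {i j : ℕ} (h : ∀ a < i, ∀ b < j, f a b = g a b) :
    rectSum f i j = rectSum g i j :=
  Finset.sum_congr rfl fun a ha => Finset.sum_congr rfl fun b hb =>
    h a (Finset.mem_range.1 ha) b (Finset.mem_range.1 hb)

/-- `μ` is obtained from `ν` by adding the single cell `(p, q)`. -/
def IsCorner (ν μ : YoungDiagram) (p q : ℕ) : Prop :=
  (p, q) ∉ ν ∧ ∀ i j, (i, j) ∈ μ ↔ (i, j) ∈ ν ∨ (i = p ∧ j = q)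

namespace IsCorner

variable {ν μ : YoungDiagram} {p q : ℕ}

theorem mem (h : IsCorner ν μ p q) : (p, q) ∈ μ :=
  (h.2 p q).2 (Or.inr ⟨rfl, rfl⟩)

theorem mem_of_lt (h : IsCorner ν μ p q) {i j : ℕ} (hi : i ≤ p) (hj : j ≤ q)
    (hne : i + j < p + q) : (i, j) ∈ ν := by
  rcases (h.2 i j).1 (μ.up_left_mem hi hj h.mem) with h' | h'
  · exact h'
  · omega

theorem eq_of_le (h : IsCorner ν μ p q) {i j : ℕ} (hi : p ≤ i) (hj : q ≤ j)
    (hmem : (i, j) ∈ μ) : i = p ∧ j = q := by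
  rcases (h.2 i j).1 hmem with h' | h'
  · exact absurd (ν.up_left_mem hi hj h') h.1
  · exact h'

theorem le_min (h : IsCorner ν μ p q) {P : ℕ → ℕ → ℕ} (hP : IsWeaklyIncreasing ν P) {i j : ℕ}
    (hd : i + q = j + p) (hi : i < p) : P i j ≤ min (P i (j + 1)) (P (i + 1) j) :=
  _root_.le_min (hP i (j + 1) (h.mem_of_lt (by omega) (by omega) (by omega))).1
    (hP (i + 1) j (h.mem_of_lt (by omega) (by omega) (by omega))).2

theorem maxPred_le (h : IsCorner ν μ p q) {P : ℕ → ℕ → ℕ} (hP : IsWeaklyIncreasing ν P) {i j : ℕ}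
    (hd : i + q = j + p) (hi : i < p) : maxPred P i j ≤ P i j :=
  have := hP i j (h.mem_of_lt (by omega) (by omega) (by omega))
  max_le this.1 this.2

theorem toggle_toggle (h : IsCorner ν μ p q) {P : ℕ → ℕ → ℕ} (hP : IsWeaklyIncreasing ν P)
    (v : ℕ) : toggle p q (toggle p q P v) (P p q) = P := by
  funext i j
  by_cases hd : i + q = j + p
  · rcases lt_trichotomy i p with hi | hi | hi
    · have h1 := h.le_min hP hd hi
      rw [toggle_of_lt _ _ hd hi, maxPred_toggle P v hd, toggle_of_lt P v hd hi,
        toggle_of_ne P v (by omega), toggle_of_ne P v (by omega)]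
      omega
    · obtain rfl : j = q := by omega
      subst hi
      exact toggle_self _ _ _ _
    · rw [toggle_of_gt _ _ hi, toggle_of_gt _ _ hi]
  · rw [toggle_of_ne _ _ hd, toggle_of_ne _ _ hd]

theorem isWeaklyIncreasing_toggle (h : IsCorner ν μ p q) {P : ℕ → ℕ → ℕ}
    (hP : IsWeaklyIncreasing ν P) (v : ℕ) : IsWeaklyIncreasing ν (toggle p q P v) := by
  intro i j hij
  by_cases hd : i + q = j + p
  · have hi : i < p := by
      by_contra hi
      exact h.1 (ν.up_left_mem (not_lt.1 hi) (by omega) hij)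
    rw [leftEntry_toggle P v hd, upEntry_toggle P v hd, toggle_of_lt P v hd hi]
    have h1 := h.le_min hP hd hi
    have h2 : leftEntry P i j ≤ maxPred P i j := le_max_left _ _
    have h3 : upEntry P i j ≤ maxPred P i j := le_max_right _ _
    omega
  · rw [toggle_of_ne P v hd]
    have hlt : ∀ a b, a ≤ i → b ≤ j → a + q = b + p → a < p := fun a b ha hb hab => by
      by_contra hap
      exact h.1 (ν.up_left_mem (by omega) (by omega) hij)
    constructor
    · rcases j with _ | j
      · exact Nat.zero_le _
      · change toggle p q P v i j ≤ _
        by_cases hd' : i + q = j + p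
        · have hi := hlt i j le_rfl (by omega) hd'
          rw [toggle_of_lt P v hd' hi]
          have h1 := h.maxPred_le hP hd' hi
          have h2 := min_le_left (P i (j + 1)) (P (i + 1) j)
          omega
        · rw [toggle_of_ne P v hd']
          exact (hP i (j + 1) hij).1
    · rcases i with _ | i
      · exact Nat.zero_le _
      · change toggle p q P v i j ≤ _
        by_cases hd' : i + q = j + p
        · have hi := hlt i j (by omega) le_rfl hd'
          rw [toggle_of_lt P v hd' hi]
          have h1 := h.maxPred_le hP hd' hi
          have h2 := min_le_right (P i (j + 1)) (P (i + 1) j)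
          omega
        · rw [toggle_of_ne P v hd']
          exact (hP (i + 1) j hij).2

theorem isWeaklyIncreasing_toggle_of_le (h : IsCorner ν μ p q) {P : ℕ → ℕ → ℕ}
    (hP : IsWeaklyIncreasing ν P) {v : ℕ} (hv : maxPred P p q ≤ v) :
    IsWeaklyIncreasing μ (toggle p q P v) := by
  intro i j hij
  rcases (h.2 i j).1 hij with hij | ⟨rfl, rfl⟩
  · exact h.isWeaklyIncreasing_toggle hP v i j hij
  · rw [toggle_self, leftEntry_toggle P v (add_comm _ _), upEntry_toggle P v (add_comm _ _)]
    exact max_le_iff.1 hv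

theorem diagSum_add_diagSum_toggle (h : IsCorner ν μ p q) {P : ℕ → ℕ → ℕ}
    (hP : IsWeaklyIncreasing ν P) (v : ℕ) {i j : ℕ} (hd : i + q = j + p) (hi : i ≤ p) :
    diagSum P i j + diagSum (toggle p q P v) i j + maxPred P i j
      = diagSum P (i + 1) j + diagSum P i (j + 1) := by
  induction i generalizing j with
  | zero => rcases j with _ | j <;> simp [diagSum, maxPred, leftEntry, upEntry]
  | succ i ih =>
    rcases j with _ | j
    · rcases i with _ | i <;> simp [diagSum, maxPred, leftEntry, upEntry]
    · have hd' : i + q = j + p := by omega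
      have h1 := h.le_min hP hd' (by omega)
      have h2 := min_add_max (P i (j + 1)) (P (i + 1) j)
      have h3 := ih hd' (by omega)
      have h4 : maxPred P (i + 1) (j + 1) = max (P i (j + 1)) (P (i + 1) j) := max_comm _ _
      rw [h4, diagSum, diagSum, diagSum, diagSum, toggle_of_lt P v hd' (by omega)]
      omega

theorem isOuterRim (h : IsCorner ν μ p q) {i j : ℕ} (hd : i + q ≠ j + p) (hij : IsOuterRim μ i j) :
    IsOuterRim ν i j := by
  refine ⟨fun h' => hij.1 ((h.2 i j).2 (Or.inl h')), ?_⟩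
  by_cases hi : i = 0
  · exact Or.inl hi
  by_cases hj : j = 0
  · exact Or.inr (Or.inl hj)
  rcases hij.2 with h' | h' | h'
  · exact Or.inl h'
  · exact Or.inr (Or.inl h')
  · rcases (h.2 _ _).1 h' with h'' | h''
    · exact Or.inr (Or.inr h'')
    · omega

/-- The diagonal sums of an array over `μ` agree with rectangle sums, provided that those of the
toggled array over `ν` do. -/
theorem diagSum_eq_rectSum (h : IsCorner ν μ p q) {P f g : ℕ → ℕ → ℕ} (hP : IsWeaklyIncreasing μ P)
    (hf : f p q = 0) (hg : g p q = P p q - maxPred P p q)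
    (hfg : ∀ a b, ¬(a = p ∧ b = q) → g a b = f a b)
    (hD : ∀ i j, IsOuterRim ν i j → diagSum (toggle p q P 0) i j = rectSum f i j)
    {i j : ℕ} (hij : IsOuterRim μ i j) : diagSum P i j = rectSum g i j := by
  have hPν : IsWeaklyIncreasing ν P := fun a b hab => hP a b ((h.2 a b).2 (Or.inl hab))
  rcases Nat.eq_zero_or_pos i with rfl | hi
  · simp [diagSum, rectSum]
  rcases Nat.eq_zero_or_pos j with rfl | hj
  · rcases i with _ | i <;> simp [diagSum, rectSum]
  have hmem : (i - 1, j - 1) ∈ μ := by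
    rcases hij.2 with h' | h' | h'
    · omega
    · omega
    · exact h'
  by_cases hd : i + q = j + p
  · have hc : i - 1 = p ∧ j - 1 = q := by
      by_cases hip : p ≤ i - 1
      · exact h.eq_of_le hip (by omega) hmem
      · exact absurd (μ.up_left_mem (by omega) (by omega) h.mem) hij.1
    obtain rfl : i = p + 1 := by omega
    obtain rfl : j = q + 1 := by omega
    have h00 : IsOuterRim ν p q := ⟨h.1, by
      by_cases hp : p = 0
      · exact Or.inl hp
      by_cases hq : q = 0
      · exact Or.inr (Or.inl hq)
      exact Or.inr (Or.inr (h.mem_of_lt (by omega) (by omega) (by omega)))⟩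
    have h10 : IsOuterRim ν (p + 1) q := ⟨fun h' => h.1 (ν.up_left_mem (by omega) le_rfl h'), by
      by_cases hq : q = 0
      · exact Or.inr (Or.inl hq)
      exact Or.inr (Or.inr (h.mem_of_lt (by omega) (by omega) (by omega)))⟩
    have h01 : IsOuterRim ν p (q + 1) := ⟨fun h' => h.1 (ν.up_left_mem le_rfl (by omega) h'), by
      by_cases hp : p = 0
      · exact Or.inl hp
      exact Or.inr (Or.inr (h.mem_of_lt (by omega) (by omega) (by omega)))⟩
    have e1 := hD _ _ h00
    have e2 := hD _ _ h10
    have e3 := hD _ _ h01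
    rw [diagSum_toggle_of_ne _ _ (by omega)] at e2 e3
    have e4 := h.diagSum_add_diagSum_toggle hPν 0 (add_comm p q) le_rfl
    have e5 := rectSum_succ_succ_add g p q
    have c1 : rectSum g p q = rectSum f p q := rectSum_congr fun a ha b hb => hfg a b (by omega)
    have c2 : rectSum g (p + 1) q = rectSum f (p + 1) q :=
      rectSum_congr fun a ha b hb => hfg a b (by omega)
    have c3 : rectSum g p (q + 1) = rectSum f p (q + 1) :=
      rectSum_congr fun a ha b hb => hfg a b (by omega)
    have e6 : maxPred P p q ≤ P p q := max_le (hP p q h.mem).1 (hP p q h.mem).2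
    rw [diagSum]
    omega
  · rw [← diagSum_toggle_of_ne P 0 hd, hD i j (h.isOuterRim hd hij)]
    refine rectSum_congr fun a ha b hb => (hfg a b ?_).symm
    rintro ⟨rfl, rfl⟩
    have := h.eq_of_le (i := i - 1) (j := j - 1) (by omega) (by omega) hmem
    omega

end IsCorner

theorem exists_isCorner {μ : YoungDiagram} (hμ : μ.cells.Nonempty) :
    ∃ (ν : YoungDiagram) (p q : ℕ), IsCorner ν μ p q ∧ ν.card < μ.card := by
  obtain ⟨⟨p, q⟩, hc, hmax⟩ := μ.cells.exists_max_image (fun c => c.1 + c.2) hμ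
  refine ⟨⟨μ.cells.erase (p, q), ?_⟩, p, q, ⟨?_, fun i j => ?_⟩, ?_⟩
  · rintro ⟨a, b⟩ ⟨a', b'⟩ ⟨h1, h2⟩ hab
    simp only [Finset.coe_erase, Set.mem_sdiff, Finset.mem_coe, Set.mem_singleton_iff,
      mem_cells, Prod.mk.injEq] at hab ⊢
    simp only at h1 h2
    refine ⟨μ.up_left_mem h1 h2 hab.1, ?_⟩
    rintro ⟨rfl, rfl⟩
    have := hmax (a, b) ((mem_cells _).2 hab.1)
    simp only at this
    omega
  · simp [← mem_cells]
  · rw [← mem_cells, ← mem_cells]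
    simp only [Finset.mem_erase, ne_eq, Prod.mk.injEq]
    by_cases h : i = p ∧ j = q
    · obtain ⟨rfl, rfl⟩ := h
      simp [hc]
    · simp [h]
  · exact Finset.card_erase_lt_of_mem hc

/-- A bijective correspondence between reverse plane partitions of shape `μ` and arbitrary fillings
of `μ`, taking diagonal sums to rectangle sums. -/
theorem exists_bijection_diagSum_eq_rectSum (μ : YoungDiagram) :
    ∃ Φ Ψ : (ℕ → ℕ → ℕ) → ℕ → ℕ → ℕ,
      (∀ P, IsFilling μ P → IsWeaklyIncreasing μ P →
        IsFilling μ (Φ P) ∧ Ψ (Φ P) = P ∧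
          ∀ i j, IsOuterRim μ i j → diagSum P i j = rectSum (Φ P) i j) ∧
      ∀ f, IsFilling μ f → IsFilling μ (Ψ f) ∧ IsWeaklyIncreasing μ (Ψ f) ∧ Φ (Ψ f) = f := by
  induction hn : μ.card using Nat.strong_induction_on generalizing μ with
  | _ n ih =>
  subst hn
  rcases μ.cells.eq_empty_or_nonempty with hμ | hμ
  · have hmem : ∀ c, c ∉ μ := fun c => by rw [← mem_cells, hμ]; exact Finset.notMem_empty c
    refine ⟨id, id, fun P hP _ => ⟨hP, rfl, fun i j hij => ?_⟩,
      fun f hf => ⟨hf, fun i j h => absurd h (hmem _), rfl⟩⟩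
    rcases hij.2 with rfl | rfl | h
    · simp [diagSum, rectSum]
    · rcases i with _ | i <;> simp [diagSum, rectSum]
    · exact absurd h (hmem _)
  obtain ⟨ν, p, q, h, hcard⟩ := exists_isCorner hμ
  obtain ⟨Φ, Ψ, hΦ, hΨ⟩ := ih ν.card hcard ν rfl
  let put (f : ℕ → ℕ → ℕ) (v i j : ℕ) : ℕ := if i = p ∧ j = q then v else f i j
  have put_self (f v) : put f v p q = v := if_pos ⟨rfl, rfl⟩
  have put_of_ne (f v) {i j} (hij : ¬(i = p ∧ j = q)) : put f v i j = f i j := if_neg hij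
  have fill_put (f v) (hf : IsFilling ν f) : IsFilling μ (put f v) := fun i j hij => by
    rw [h.2, not_or] at hij
    rw [put_of_ne _ _ hij.2, hf i j hij.1]
  have fill_toggle (P v) (hP : IsFilling ν P) : IsFilling μ (toggle p q P v) := fun i j hij => by
    by_cases hd : i + q = j + p
    · rcases lt_trichotomy i p with hi | hi | hi
      · exact absurd (μ.up_left_mem (by omega) (by omega) h.mem) hij
      · obtain rfl : j = q := by omega
        subst hi
        exact absurd h.mem hij
      · rw [toggle_of_gt _ _ hi]
        exact hP i j fun h' => hij ((h.2 i j).2 (Or.inl h'))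
    · rw [toggle_of_ne _ _ hd]
      exact hP i j fun h' => hij ((h.2 i j).2 (Or.inl h'))
  have fill_toggle_zero (P) (hP : IsFilling μ P) : IsFilling ν (toggle p q P 0) := fun i j hij => by
    by_cases hc : i = p ∧ j = q
    · rw [hc.1, hc.2, toggle_self]
    have hij' : (i, j) ∉ μ := by
      rw [h.2, not_or]
      exact ⟨hij, hc⟩
    by_cases hd : i + q = j + p
    · rcases lt_trichotomy i p with hi | hi | hi
      · exact absurd (μ.up_left_mem (by omega) (by omega) h.mem) hij'
      · omega
      · rw [toggle_of_gt _ _ hi, hP i j hij']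
    · rw [toggle_of_ne _ _ hd, hP i j hij']
  refine ⟨fun P => put (Φ (toggle p q P 0)) (P p q - maxPred P p q),
    fun f => toggle p q (Ψ (put f 0)) (f p q + maxPred (Ψ (put f 0)) p q),
    fun P hP hP' => ?_, fun f hf => ?_⟩
  · have hPν : IsWeaklyIncreasing ν P := fun a b hab => hP' a b ((h.2 a b).2 (Or.inl hab))
    obtain ⟨h1, h2, h3⟩ := hΦ _ (fill_toggle_zero P hP) (h.isWeaklyIncreasing_toggle hPν 0)
    refine ⟨fill_put _ _ h1, ?_, fun i j hij => ?_⟩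
    · have e : put (put (Φ (toggle p q P 0)) (P p q - maxPred P p q)) 0 = Φ (toggle p q P 0) := by
        funext i j
        by_cases hc : i = p ∧ j = q
        · rw [hc.1, hc.2, put_self, h1 p q h.1]
        · rw [put_of_ne _ _ hc, put_of_ne _ _ hc]
      have e6 : maxPred P p q ≤ P p q := max_le (hP' p q h.mem).1 (hP' p q h.mem).2
      simp only
      rw [e, h2, put_self, maxPred_toggle P 0 (add_comm p q), Nat.sub_add_cancel e6,
        h.toggle_toggle hPν]
    · exact h.diagSum_eq_rectSum hP' (h1 p q h.1) (put_self _ _)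
        (fun a b hab => put_of_ne _ _ hab) h3 hij
  · have hf0 : IsFilling ν (put f 0) := fun i j hij => by
      by_cases hc : i = p ∧ j = q
      · rw [hc.1, hc.2, put_self]
      · rw [put_of_ne _ _ hc]
        exact hf i j (by rw [h.2, not_or]; exact ⟨hij, hc⟩)
    obtain ⟨h1, h2, h3⟩ := hΨ _ hf0
    refine ⟨fill_toggle _ _ h1, h.isWeaklyIncreasing_toggle_of_le h2 (Nat.le_add_left _ _), ?_⟩
    have e := h.toggle_toggle h2 (f p q + maxPred (Ψ (put f 0)) p q)
    rw [h1 p q h.1] at e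
    simp only
    rw [e, h3, toggle_self, maxPred_toggle _ _ (add_comm p q), Nat.add_sub_cancel]
    funext i j
    by_cases hc : i = p ∧ j = q
    · rw [hc.1, hc.2, put_self]
    · rw [put_of_ne _ _ hc, put_of_ne _ _ hc]

/-- Shifting along the diagonals preserves the sum over `μ` of a function that vanishes on the axes
and diagonally below `μ`. -/
theorem sum_cells_succ_succ {M : Type*} [AddCommMonoid M] (μ : YoungDiagram) (K : ℕ → ℕ → M)
    (hK : ∀ i j, i = 0 ∨ j = 0 ∨ ((i - 1, j - 1) ∈ μ ∧ (i, j) ∉ μ) → K i j = 0) :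
    ∑ c ∈ μ.cells, K (c.1 + 1) (c.2 + 1) = ∑ c ∈ μ.cells, K c.1 c.2 := by
  refine Finset.sum_bij_ne_zero (fun c _ _ => (c.1 + 1, c.2 + 1)) ?_ ?_ ?_ ?_
  · rintro ⟨i, j⟩ h1 h2
    by_contra h3
    exact h2 (hK _ _ (Or.inr (Or.inr ⟨by simpa using h1, by simpa using h3⟩)))
  · rintro ⟨i, j⟩ _ _ ⟨i', j'⟩ _ _ h
    simpa using h
  · rintro ⟨i, j⟩ h1 h2
    have hi : i ≠ 0 := fun h => h2 (hK _ _ (Or.inl h))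
    have hj : j ≠ 0 := fun h => h2 (hK _ _ (Or.inr (Or.inl h)))
    obtain ⟨i, rfl⟩ := Nat.exists_eq_succ_of_ne_zero hi
    obtain ⟨j, rfl⟩ := Nat.exists_eq_succ_of_ne_zero hj
    exact ⟨(i, j), (mem_cells _).2 (μ.up_left_mem (by omega) (by omega) ((mem_cells _).1 h1)),
      h2, rfl⟩
  · intros
    rfl

theorem sum_cells_row (μ : YoungDiagram) (f : ℕ → ℕ → ℕ) :
    ∑ c ∈ μ.cells, ∑ b ∈ Finset.range (c.2 + 1), f c.1 b
      = ∑ c ∈ μ.cells, (μ.rowLen c.1 - c.2) * f c.1 c.2 := by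
  have key : ∀ c ∈ μ.cells, (μ.rowLen c.1 - c.2) * f c.1 c.2
      = ∑ _b ∈ Finset.Ico c.2 (μ.rowLen c.1), f c.1 c.2 := fun c _ => by simp
  rw [Finset.sum_congr rfl key, Finset.sum_sigma', Finset.sum_sigma']
  refine Finset.sum_bij' (fun x _ => ⟨(x.1.1, x.2), x.1.2⟩) (fun x _ => ⟨(x.1.1, x.2), x.1.2⟩)
    ?_ ?_ ?_ ?_ ?_
  · rintro ⟨⟨i, j⟩, b⟩ h
    simp only [Finset.mem_sigma, mem_cells, mem_iff_lt_rowLen, Finset.mem_range,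
      Finset.mem_Ico] at h ⊢
    omega
  · rintro ⟨⟨i, j⟩, b⟩ h
    simp only [Finset.mem_sigma, mem_cells, mem_iff_lt_rowLen, Finset.mem_range,
      Finset.mem_Ico] at h ⊢
    omega
  all_goals intros; rfl

theorem sum_cells_col (μ : YoungDiagram) (f : ℕ → ℕ → ℕ) :
    ∑ c ∈ μ.cells, ∑ a ∈ Finset.range c.1, f a c.2
      = ∑ c ∈ μ.cells, (μ.colLen c.2 - (c.1 + 1)) * f c.1 c.2 := by
  have key : ∀ c ∈ μ.cells, (μ.colLen c.2 - (c.1 + 1)) * f c.1 c.2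
      = ∑ _b ∈ Finset.Ico (c.1 + 1) (μ.colLen c.2), f c.1 c.2 := fun c _ => by simp
  rw [Finset.sum_congr rfl key, Finset.sum_sigma', Finset.sum_sigma']
  refine Finset.sum_bij' (fun x _ => ⟨(x.2, x.1.2), x.1.1⟩) (fun x _ => ⟨(x.2, x.1.2), x.1.1⟩)
    ?_ ?_ ?_ ?_ ?_
  · rintro ⟨⟨i, j⟩, b⟩ h
    simp only [Finset.mem_sigma, mem_cells, mem_iff_lt_colLen, Finset.mem_range,
      Finset.mem_Ico] at h ⊢
    omega
  · rintro ⟨⟨i, j⟩, b⟩ h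
    simp only [Finset.mem_sigma, mem_cells, mem_iff_lt_colLen, Finset.mem_range,
      Finset.mem_Ico] at h ⊢
    omega
  all_goals intros; rfl

theorem sum_cells_eq_sum_hookLength_mul (μ : YoungDiagram) {P f : ℕ → ℕ → ℕ}
    (h : ∀ i j, IsOuterRim μ i j → diagSum P i j = rectSum f i j) :
    ∑ c ∈ μ.cells, P c.1 c.2 = ∑ c ∈ μ.cells, μ.hookLength c * f c.1 c.2 := by
  have hK := sum_cells_succ_succ μ (fun i j => (diagSum P i j : ℤ) - rectSum f i j) (by
    rintro i j (rfl | rfl | ⟨h1, h2⟩)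
    · simp [diagSum, rectSum]
    · rcases i with _ | i <;> simp [diagSum, rectSum]
    · rw [h i j ⟨h2, Or.inr (Or.inr h1)⟩, sub_self])
  have hhook : ∀ c ∈ μ.cells, μ.hookLength c * f c.1 c.2
      = (μ.rowLen c.1 - c.2) * f c.1 c.2 + (μ.colLen c.2 - (c.1 + 1)) * f c.1 c.2 := by
    rintro ⟨i, j⟩ hc
    have hr := mem_iff_lt_rowLen.1 ((mem_cells _).1 hc)
    have hl := mem_iff_lt_colLen.1 ((mem_cells _).1 hc)
    rw [← add_mul]
    congr 1
    simp only [hookLength]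
    omega
  rw [Finset.sum_congr rfl hhook, Finset.sum_add_distrib, ← sum_cells_row, ← sum_cells_col,
    ← Finset.sum_add_distrib]
  simp only [diagSum, rectSum_succ_succ] at hK
  push_cast at hK
  rw [← sub_eq_zero, ← Finset.sum_sub_distrib] at hK
  zify
  rw [← sub_eq_zero, ← Finset.sum_sub_distrib, ← hK]
  exact Finset.sum_congr rfl fun c _ => by ring

theorem hookLength_pos {μ : YoungDiagram} {c : ℕ × ℕ} (hc : c ∈ μ.cells) : 0 < μ.hookLength c := by
  obtain ⟨i, j⟩ := c
  have hr := mem_iff_lt_rowLen.1 ((mem_cells _).1 hc)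
  have hl := mem_iff_lt_colLen.1 ((mem_cells _).1 hc)
  simp only [hookLength]
  omega

theorem IsWeaklyIncreasing.row_le {μ : YoungDiagram} {P : ℕ → ℕ → ℕ} (hP : IsWeaklyIncreasing μ P)
    {i j j' : ℕ} (hj : j ≤ j') (h : (i, j') ∈ μ) : P i j ≤ P i j' := by
  induction j', hj using Nat.le_induction with
  | base => rfl
  | succ j' _ ih => exact (ih (μ.up_left_mem le_rfl (by omega) h)).trans (hP i (j' + 1) h).1

theorem IsWeaklyIncreasing.col_le {μ : YoungDiagram} {P : ℕ → ℕ → ℕ} (hP : IsWeaklyIncreasing μ P)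
    {i i' j : ℕ} (hi : i ≤ i') (h : (i', j) ∈ μ) : P i j ≤ P i' j := by
  induction i', hi using Nat.le_induction with
  | base => rfl
  | succ i' _ ih => exact (ih (μ.up_left_mem (by omega) le_rfl h)).trans (hP (i' + 1) j h).2

end YoungDiagram

namespace SemistandardYoungTableau

open YoungDiagram

variable {μ : YoungDiagram}

theorem row_index_le (T : SemistandardYoungTableau μ) {i j : ℕ} (h : (i, j) ∈ μ) : i ≤ T i j := by
  induction i with
  | zero => exact Nat.zero_le _
  | succ i ih =>
    have h1 := ih (μ.up_left_mem (by omega) le_rfl h)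
    have h2 := T.col_strict (Nat.lt_add_one i) h
    omega

/-- The array obtained from a semistandard tableau by subtracting `i` from the entries in row `i`;
it is a reverse plane partition. -/
def subRow (T : SemistandardYoungTableau μ) (i j : ℕ) : ℕ :=
  T i j - i

theorem isFilling_subRow (T : SemistandardYoungTableau μ) : IsFilling μ T.subRow := fun i j h => by
  simp [subRow, T.zeros h]

theorem isWeaklyIncreasing_subRow (T : SemistandardYoungTableau μ) :
    IsWeaklyIncreasing μ T.subRow := fun i j h => by
  constructor
  · rcases j with _ | j
    · exact Nat.zero_le _
    · exact Nat.sub_le_sub_right (T.row_weak (Nat.lt_add_one j) h) i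
  · rcases i with _ | i
    · exact Nat.zero_le _
    · have := T.col_strict (Nat.lt_add_one i) h
      simp only [upEntry, subRow]
      omega

theorem subRow_injective : Function.Injective (subRow (μ := μ)) := fun T T' h => by
  ext i j
  by_cases hij : (i, j) ∈ μ
  · have h1 := T.row_index_le hij
    have h2 := T'.row_index_le hij
    have h3 : T i j - i = T' i j - i := congrFun (congrFun h i) j
    omega
  · rw [T.zeros hij, T'.zeros hij]

theorem exists_subRow_eq {P : ℕ → ℕ → ℕ} (hP : IsFilling μ P) (hP' : IsWeaklyIncreasing μ P) :
    ∃ T : SemistandardYoungTableau μ, T.subRow = P := by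
  refine ⟨⟨fun i j => if (i, j) ∈ μ then P i j + i else 0, ?_, ?_, fun h => if_neg h⟩, ?_⟩
  · intro i j j' hj h
    rw [if_pos h, if_pos (μ.up_left_mem le_rfl hj.le h)]
    exact Nat.add_le_add_right (hP'.row_le hj.le h) i
  · intro i i' j hi h
    rw [if_pos h, if_pos (μ.up_left_mem hi.le le_rfl h)]
    exact add_lt_add_of_le_of_lt (hP'.col_le hi.le h) hi
  · funext i j
    change (if (i, j) ∈ μ then P i j + i else 0) - i = P i j
    by_cases h : (i, j) ∈ μ
    · simp [h]
    · simp [h, hP i j h]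

theorem sum_cells_eq (T : SemistandardYoungTableau μ) :
    ∑ c ∈ μ.cells, T c.1 c.2 = μ.nStat + ∑ c ∈ μ.cells, T.subRow c.1 c.2 := by
  rw [nStat, ← Finset.sum_add_distrib]
  exact Finset.sum_congr rfl fun c hc => (Nat.add_sub_cancel' (T.row_index_le hc)).symm

/-- Semistandard tableaux of shape `μ` correspond to functions on the cells of `μ` whose value at
every cell is a multiple of the hook length. -/
theorem exists_bijOn_hookLength_dvd (μ : YoungDiagram) :
    ∃ F : SemistandardYoungTableau μ → (ℕ × ℕ →₀ ℕ), ∀ k : ℕ,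
      Set.BijOn F {T | ∑ c ∈ μ.cells, T c.1 c.2 = μ.nStat + k}
        ({l ∈ μ.cells.finsuppAntidiag k | ∀ c ∈ μ.cells, μ.hookLength c ∣ l c} : Finset _) := by
  obtain ⟨Φ, Ψ, hΦ, hΨ⟩ := exists_bijection_diagSum_eq_rectSum μ
  have hΦ' (T : SemistandardYoungTableau μ) :=
    hΦ T.subRow T.isFilling_subRow T.isWeaklyIncreasing_subRow
  let F (T : SemistandardYoungTableau μ) : ℕ × ℕ →₀ ℕ :=
    Finsupp.onFinset μ.cells (fun c => μ.hookLength c * Φ T.subRow c.1 c.2) fun c hc => by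
      by_contra h
      exact hc (by rw [(hΦ' T).1 c.1 c.2 h, mul_zero])
  have hF (T : SemistandardYoungTableau μ) (c) :
      F T c = μ.hookLength c * Φ T.subRow c.1 c.2 := rfl
  have hsum (T : SemistandardYoungTableau μ) :
      ∑ c ∈ μ.cells, T.subRow c.1 c.2 = ∑ c ∈ μ.cells, F T c :=
    sum_cells_eq_sum_hookLength_mul μ (hΦ' T).2.2
  refine ⟨F, fun k => ⟨fun T hT => ?_, fun T _ T' _ hTT' => ?_, fun l hl => ?_⟩⟩
  · simp only [Set.mem_ofPred_eq, sum_cells_eq, hsum, Nat.add_left_cancel_iff] at hT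
    simp only [Finset.coe_filter, Finset.mem_finsuppAntidiag, Set.mem_ofPred_eq]
    exact ⟨⟨hT, Finsupp.support_onFinset_subset⟩, fun c _ => Dvd.intro _ rfl⟩
  · refine subRow_injective ?_
    rw [← (hΦ' T).2.1, ← (hΦ' T').2.1]
    congr 1
    funext i j
    by_cases h : (i, j) ∈ μ
    · exact Nat.eq_of_mul_eq_mul_left (hookLength_pos ((mem_cells _).2 h))
        (DFunLike.congr_fun hTT' (i, j))
    · rw [(hΦ' T).1 i j h, (hΦ' T').1 i j h]
  · simp only [Finset.coe_filter, Finset.mem_finsuppAntidiag, Set.mem_ofPred_eq] at hl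
    have hsupp (c) (hc : c ∉ μ) : l c = 0 := by
      by_contra h
      exact hc ((mem_cells _).1 (hl.1.2 (Finsupp.mem_support_iff.2 h)))
    obtain ⟨h1, h2, h3⟩ := hΨ (fun i j => l (i, j) / μ.hookLength (i, j)) fun i j hij => by
      simp [hsupp _ hij]
    obtain ⟨T, hT⟩ := exists_subRow_eq h1 h2
    have hFT : F T = l := by
      ext c
      rw [hF, hT, h3]
      by_cases hc : c ∈ μ
      · exact Nat.mul_div_cancel' (hl.2 c ((mem_cells _).2 hc))
      · simp [hsupp c hc]
    refine ⟨T, ?_, hFT⟩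
    rw [Set.mem_ofPred_eq, sum_cells_eq, hsum, hFT]
    exact congrArg _ hl.1.1

end SemistandardYoungTableau

namespace PowerSeries

theorem mk_dvd_mul_one_sub_X_pow {R : Type*} [CommRing R] {h : ℕ} (hh : 0 < h) :
    (mk fun m => if h ∣ m then (1 : R) else 0) * (1 - X ^ h) = 1 := by
  ext m
  rw [mul_sub, mul_one, map_sub, coeff_mk, coeff_mul_X_pow', coeff_mk, coeff_one]
  rcases lt_or_ge m h with hm | hm
  · rcases Nat.eq_zero_or_pos m with rfl | hm0
    · simp [hh.ne']
    · simp [hm.not_ge, hm0.ne', Nat.not_dvd_of_pos_of_lt hm0 hm]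
  · obtain ⟨k, rfl⟩ := Nat.exists_eq_add_of_le hm
    simp [hh.ne']

/-- The generating function for the functions on a finite set whose value at each point `i` is a
multiple of `h i`. -/
theorem mk_card_finsuppAntidiag_dvd_mul_prod {R ι : Type*} [CommRing R] [DecidableEq ι]
    (s : Finset ι) (h : ι → ℕ) (hh : ∀ i ∈ s, 0 < h i) :
    (mk fun m => (({l ∈ s.finsuppAntidiag m | ∀ i ∈ s, h i ∣ l i} : Finset _).card : R))
      * ∏ i ∈ s, (1 - X ^ h i) = 1 := by
  have key : (mk fun m => (({l ∈ s.finsuppAntidiag m | ∀ i ∈ s, h i ∣ l i} : Finset _).card : R))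
      = ∏ i ∈ s, mk fun m => if h i ∣ m then (1 : R) else 0 := by
    ext m
    simp only [coeff_prod, coeff_mk, Finset.prod_boole, Finset.sum_boole]
  rw [key, ← Finset.prod_mul_distrib]
  exact Finset.prod_eq_one fun i hi => mk_dvd_mul_one_sub_X_pow (hh i hi)

end PowerSeries

/-- For a partition `ρ`: for each `m`, the set of semistandard Young tableaux of shape `ρ`
(entries in ℕ, weakly increasing along rows, strictly increasing down columns) whose entries
sum to `m` is finite, and, writing `a_m` for its cardinality, in `ℤ⟦q⟧` one has
`(∑_{m ≥ 0} a_m q^m) · ∏_{x ∈ ρ} (1 − q^{h(x)}) = q^{n(ρ)}`;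
i.e. the principal specialization `s_ρ(1, q, q², …)` equals
`q^{n(ρ)} / ∏_{x ∈ ρ} (1 − q^{h(x)})`. -/
theorem ssyt_generating_function_hook (μ : YoungDiagram) :
    (∀ m : ℕ,
      {T : SemistandardYoungTableau μ | (∑ c ∈ μ.cells, T c.1 c.2) = m}.Finite) ∧
    (PowerSeries.mk fun m =>
        ({T : SemistandardYoungTableau μ | (∑ c ∈ μ.cells, T c.1 c.2) = m}.ncard : ℤ))
      * (∏ c ∈ μ.cells, (1 - PowerSeries.X ^ μ.hookLength c))
      = (PowerSeries.X : PowerSeries ℤ) ^ μ.nStat := by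
  obtain ⟨F, hF⟩ := SemistandardYoungTableau.exists_bijOn_hookLength_dvd μ
  have hlt (m : ℕ) (hm : m < μ.nStat) :
      {T : SemistandardYoungTableau μ | (∑ c ∈ μ.cells, T c.1 c.2) = m} = ∅ :=
    Set.eq_empty_of_forall_notMem fun T hT => by
      rw [Set.mem_ofPred_eq, T.sum_cells_eq] at hT
      omega
  constructor
  · intro m
    rcases lt_or_ge m μ.nStat with hm | hm
    · rw [hlt m hm]
      exact Set.finite_empty
    · obtain ⟨k, rfl⟩ := Nat.exists_eq_add_of_le hm
      exact (hF k).finite_iff_finite.2 (Finset.finite_toSet _)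
  · have key : (PowerSeries.mk fun m =>
        ({T : SemistandardYoungTableau μ | (∑ c ∈ μ.cells, T c.1 c.2) = m}.ncard : ℤ))
        = PowerSeries.X ^ μ.nStat * PowerSeries.mk fun k =>
          (({l ∈ μ.cells.finsuppAntidiag k | ∀ c ∈ μ.cells, μ.hookLength c ∣ l c} :
            Finset _).card : ℤ) := by
      ext m
      rw [PowerSeries.coeff_X_pow_mul', PowerSeries.coeff_mk]
      rcases lt_or_ge m μ.nStat with hm | hm
      · rw [hlt m hm, if_neg hm.not_ge, Set.ncard_empty, Nat.cast_zero]
      · obtain ⟨k, rfl⟩ := Nat.exists_eq_add_of_le hm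
        rw [if_pos hm, PowerSeries.coeff_mk, Nat.add_sub_cancel_left, ← Set.ncard_coe_finset,
          ← (hF k).image_eq, (hF k).injOn.ncard_image]
    rw [key, mul_assoc, PowerSeries.mk_card_finsuppAntidiag_dvd_mul_prod _ _
      fun c hc => YoungDiagram.hookLength_pos hc, mul_one]
end

section
/- Let l ≥ 1 be an integer and let c₀, c₁, …, c_l be elements of a field of characteristic zero (e.g. ℚ). Then the system of l linear equations ∑_{k=i}^{l} (k!/(k−i)!)·c_k = 0 for all integers i with 0 ≤ i ≤ l−1 holds if and only if c_k = (−1)^k·binom(l,k)·c₀ for all 0 ≤ k ≤ l. In particular, the solution space of this system is one-dimensional, spanned by the vector ((−1)^k binom(l,k))_{k=0,…,l}. -/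
open Polynomial in
/-- The Taylor coefficients at `1` of `∑ k ≤ l, c k X ^ k` are, up to the factor `i !`, the sums
of the `c k` weighted by falling factorials. -/
theorem factorial_mul_coeff_taylor_one {R : Type*} [CommRing R] (l i : ℕ) (c : ℕ → R) :
    (Nat.factorial i : R) *
        (taylor 1 (∑ k ∈ Finset.range (l + 1), monomial k (c k))).coeff i =
      ∑ k ∈ Finset.Icc i l, (Nat.descFactorial k i : R) * c k := by
  have hsub : Finset.Icc i l ⊆ Finset.range (l + 1) := fun k hk => by
    simp only [Finset.mem_Icc, Finset.mem_range] at *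
    omega
  rw [taylor_coeff, map_sum, eval_finsetSum, Finset.mul_sum, Finset.sum_subset hsub]
  · refine Finset.sum_congr rfl fun k _ => ?_
    rw [hasseDeriv_monomial, eval_monomial, Nat.descFactorial_eq_factorial_mul_choose]
    push_cast
    ring
  · intro k hk hki
    have hlt : k < i := by
      simp only [Finset.mem_Icc, Finset.mem_range] at *
      omega
    rw [Nat.descFactorial_of_lt hlt, Nat.cast_zero, zero_mul]

open Polynomial in
theorem taylor_C_mul_X_sub_C_pow {R : Type*} [CommRing R] (r a : R) (l : ℕ) :
    taylor r (C a * (X - C r) ^ l) = C a * X ^ l := by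
  simp [taylor_mul, taylor_pow]

open Polynomial in
theorem coeff_sum_range_monomial {R : Type*} [Semiring R] (l n : ℕ) (c : ℕ → R) :
    (∑ k ∈ Finset.range (l + 1), monomial k (c k)).coeff n = if n ≤ l then c n else 0 := by
  simp [coeff_monomial]


open Polynomial in
theorem coeff_X_sub_C_one_pow {R : Type*} [CommRing R] (l k : ℕ) :
    ((X - C (1 : R)) ^ l).coeff k = (-1) ^ (l - k) * (l.choose k : R) := by
  rw [sub_eq_add_neg, ← C_neg, coeff_X_add_C_pow]

/-- Let `l ≥ 1` and let `c₀, …, c_l` lie in a field of characteristic zero.  The system of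
`l` linear equations `∑_{k=i}^{l} (k!/(k−i)!) c_k = 0` for `0 ≤ i ≤ l − 1` (where
`k!/(k−i)!` is the falling factorial `Nat.descFactorial k i`) holds if and only if
`c_k = (−1)^k binom(l,k) c₀` for all `0 ≤ k ≤ l`.  In particular the solution space is
one-dimensional, spanned by `((−1)^k binom(l,k))_{k=0,…,l}`. -/
theorem falling_factorial_system_iff (K : Type*) [Field K] [CharZero K]
    (l : ℕ) (hl : 1 ≤ l) (c : ℕ → K) :
    (∀ i : ℕ, i < l →
        ∑ k ∈ Finset.Icc i l, (Nat.descFactorial k i : K) * c k = 0)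
      ↔ (∀ k : ℕ, k ≤ l → c k = (-1) ^ k * (Nat.choose l k : K) * c 0) := by
  set P : Polynomial K := ∑ k ∈ Finset.range (l + 1), Polynomial.monomial k (c k) with hP
  have hcoeff : ∀ n, P.coeff n = if n ≤ l then c n else 0 :=
    fun n => coeff_sum_range_monomial l n c
  have hdeg : P.natDegree ≤ l := Polynomial.natDegree_le_iff_coeff_eq_zero.2 fun n hn => by
    rw [hcoeff, if_neg (by omega)]
  constructor
  · intro h
    have hT : Polynomial.taylor 1 P =
        Polynomial.C ((Polynomial.taylor 1 P).coeff l) * Polynomial.X ^ l := by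
      ext i
      rw [Polynomial.coeff_C_mul_X_pow]
      split_ifs with hi
      · rw [hi]
      rcases lt_or_gt_of_ne hi with hlt | hgt
      · have hi0 := factorial_mul_coeff_taylor_one l i c
        rw [h i hlt] at hi0
        exact (mul_eq_zero.1 hi0).resolve_left (Nat.cast_ne_zero.2 i.factorial_ne_zero)
      · apply Polynomial.coeff_eq_zero_of_natDegree_lt
        rw [Polynomial.natDegree_taylor]
        omega
    obtain ⟨a, ha⟩ : ∃ a, P = Polynomial.C a * (Polynomial.X - Polynomial.C 1) ^ l :=
      ⟨_, Polynomial.taylor_injective 1 (hT.trans (taylor_C_mul_X_sub_C_pow 1 _ l).symm)⟩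
    have hc : ∀ k, k ≤ l → c k = a * ((-1) ^ (l - k) * (Nat.choose l k : K)) := fun k hk => by
      rw [← coeff_X_sub_C_one_pow, ← Polynomial.coeff_C_mul, ← ha, hcoeff, if_pos hk]
    intro k hk
    rw [hc k hk, hc 0 (Nat.zero_le l)]
    obtain ⟨m, rfl⟩ := Nat.exists_eq_add_of_le hk
    have hs : ((-1 : K) ^ k) * (-1) ^ k = 1 := by rw [← mul_pow]; simp
    simp only [Nat.add_sub_cancel_left, Nat.sub_zero, Nat.choose_zero_right, pow_add]
    push_cast
    linear_combination (-a * (-1) ^ m * (Nat.choose (k + m) k : K)) * hs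
  · intro h i hi
    have ha : P = Polynomial.C ((-1) ^ l * c 0) * (Polynomial.X - Polynomial.C 1) ^ l := by
      ext k
      rw [hcoeff, Polynomial.coeff_C_mul, coeff_X_sub_C_one_pow]
      split_ifs with hk
      · rw [h k hk]
        obtain ⟨m, rfl⟩ := Nat.exists_eq_add_of_le hk
        have hs : ((-1 : K) ^ m) * (-1) ^ m = 1 := by rw [← mul_pow]; simp
        simp only [Nat.add_sub_cancel_left, pow_add]
        linear_combination (-(-1) ^ k * c 0 * (Nat.choose (k + m) k : K)) * hs
      · rw [Nat.choose_eq_zero_of_lt (by omega)]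
        simp
    rw [← factorial_mul_coeff_taylor_one, ← hP, ha, taylor_C_mul_X_sub_C_pow,
      Polynomial.coeff_C_mul_X_pow, if_neg hi.ne, mul_zero]
end

section
/- Let r ≥ 0 be an integer and let J₀, J₁, …, J_r be polynomials in ℝ[τ] with deg J_k ≤ r − k for each 0 ≤ k ≤ r. Suppose that for every integer i with 0 ≤ i ≤ r−1, the polynomial ∑_{k=0}^{r} (r−k)^i · τ^k · J_k(τ) has degree at most i (with the convention 0⁰ = 1). Then for every 0 ≤ k ≤ r, k!·J_k = (−1)^k · (d/dτ)^k J₀; in particular J₁ = −dJ₀/dτ. -/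
open Polynomial

/-- The alternating binomial sum of a power of degree `i < m` vanishes. -/
lemma sum_neg_one_pow_mul_choose_mul_sub_pow_eq_zero {R : Type*} [CommRing R]
    {i m : ℕ} (h : i < m) (x : R) :
    ∑ k ∈ Finset.range (m + 1), (-1 : R) ^ k * (m.choose k : R) * (x - k) ^ i = 0 := by
  have hP : ((C x - X : R[X]) ^ i).natDegree < m := by
    have h1 : (C x - X : R[X]).natDegree ≤ 1 :=
      (natDegree_sub_le _ _).trans (by simp [natDegree_X_le])
    exact (natDegree_pow_le_of_le i h1).trans_lt (by simpa using h)
  have key := congrFun (Polynomial.fwdDiff_iter_eq_zero_of_degree_lt hP) 0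
  rw [fwdDiff_iter_eq_sum_shift] at key
  have h2 : ∑ k ∈ Finset.range (m + 1), (-1 : R) ^ k * (m.choose k : R) * (x - k) ^ i
      = (-1) ^ m * ∑ k ∈ Finset.range (m + 1), ((-1 : ℤ) ^ (m - k) * m.choose k) •
        ((C x - X : R[X]) ^ i).eval (0 + k • (1 : R)) := by
    rw [Finset.mul_sum]
    refine Finset.sum_congr rfl fun k hk => ?_
    obtain ⟨j, rfl⟩ := Nat.exists_eq_add_of_le (Finset.mem_range_succ_iff.mp hk)
    have hj : (-1 : R) ^ j * (-1) ^ j = 1 := by rw [← mul_pow]; simp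
    simp only [zsmul_eq_mul, add_tsub_cancel_left, eval_pow, eval_sub, eval_C, eval_X,
      nsmul_eq_mul, mul_one, zero_add, pow_add]
    push_cast
    linear_combination (-(-1 : R) ^ k * ((k + j).choose k : R) * (x - k) ^ i) * hj
  rw [h2, key]
  simp

/-- A vector on `{0, …, m}` annihilating the powers `(x - k) ^ i` with `i < m` is a multiple of
the alternating binomial vector. -/
lemma eq_neg_one_pow_mul_choose_mul_of_sum_mul_sub_pow_eq_zero {R : Type*} [CommRing R] [IsDomain R]
    [CharZero R] {m : ℕ} (x : R) (a : ℕ → R)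
    (ha : ∀ i < m, ∑ k ∈ Finset.range (m + 1), a k * (x - k) ^ i = 0) {k : ℕ} (hk : k ≤ m) :
    a k = (-1) ^ k * (m.choose k : R) * a 0 := by
  rcases k with _ | k
  · simp
  have hinj : Function.Injective fun j : Fin m => x - ((j + 1 : ℕ) : R) := fun p q hpq => by
    simpa [Fin.ext_iff] using hpq
  have hv := Matrix.eq_zero_of_forall_pow_sum_mul_pow_eq_zero
    (v := fun j : Fin m => a (j + 1) - (-1) ^ (j + 1 : ℕ) * (m.choose (j + 1) : R) * a 0)
    hinj fun i => by
      have h1 := ha i i.2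
      have h2 := sum_neg_one_pow_mul_choose_mul_sub_pow_eq_zero i.2 x
      rw [Finset.sum_range_succ'] at h1 h2
      simp only [sub_mul, Finset.sum_sub_distrib, mul_right_comm _ (a 0), ← Finset.sum_mul]
      rw [Fin.sum_univ_eq_sum_range (fun j => a (j + 1) * (x - ((j + 1 : ℕ) : R)) ^ (i : ℕ)),
        Fin.sum_univ_eq_sum_range (fun j => (-1) ^ (j + 1) * (m.choose (j + 1) : R) *
          (x - ((j + 1 : ℕ) : R)) ^ (i : ℕ))]
      simp only [pow_zero, Nat.choose_zero_right, Nat.cast_one, one_mul] at h2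
      linear_combination h1 - a 0 * h2
  exact sub_eq_zero.mp (congrFun hv ⟨k, hk⟩)

/-- Let `r ≥ 0` and let `J₀, …, J_r ∈ ℝ[τ]` with `deg J_k ≤ r − k`.  Suppose that for
every `0 ≤ i ≤ r − 1` the polynomial `∑_{k=0}^{r} (r−k)^i τ^k J_k(τ)` has degree at most
`i` (with the convention `0⁰ = 1`).  Then for every `0 ≤ k ≤ r` one has
`k! · J_k = (−1)^k (d/dτ)^k J₀`; in particular `J₁ = −dJ₀/dτ`. -/
theorem polys_determined_by_degree_bounds (r : ℕ) (J : ℕ → Polynomial ℝ)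
    (hdeg : ∀ k : ℕ, k ≤ r → (J k).degree ≤ (r - k : ℕ))
    (hsum : ∀ i : ℕ, i < r →
        (∑ k ∈ Finset.range (r + 1),
            Polynomial.C (((r - k : ℕ) : ℝ) ^ i) * Polynomial.X ^ k * J k).degree
          ≤ ((i : ℕ) : WithBot ℕ)) :
    ∀ k : ℕ, k ≤ r →
      ((Nat.factorial k : ℝ)) • J k = ((-1 : ℝ)) ^ k • (Polynomial.derivative^[k] (J 0)) := by
  intro k hk
  ext n
  rw [coeff_smul, coeff_smul, coeff_iterate_derivative, smul_eq_mul, smul_eq_mul, nsmul_eq_mul]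
  rcases lt_or_ge r (n + k) with hn | hn
  · rw [coeff_eq_zero_of_degree_lt ((hdeg k hk).trans_lt (Nat.cast_lt.mpr (by lia))),
      coeff_eq_zero_of_degree_lt ((hdeg 0 r.zero_le).trans_lt (Nat.cast_lt.mpr (by lia)))]
    simp
  have key := eq_neg_one_pow_mul_choose_mul_of_sum_mul_sub_pow_eq_zero (m := n + k) (r : ℝ)
    (fun l => (J l).coeff (n + k - l)) (fun i hi => by
      have h := coeff_eq_zero_of_degree_lt ((hsum i (by lia)).trans_lt (Nat.cast_lt.mpr hi))
      simp only [finsetSum_coeff, mul_assoc, coeff_C_mul, coeff_X_pow_mul'] at h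
      rw [← h]
      refine Finset.sum_subset_zero_on_sdiff (Finset.range_subset_range.mpr (by lia)) ?_ ?_
      · intro l hl
        rw [if_neg (by simp at hl; lia), mul_zero]
      · intro l hl
        have hl' : l ≤ n + k := Finset.mem_range_succ_iff.mp hl
        rw [if_pos hl', Nat.cast_sub (hl'.trans hn), mul_comm])
    (Nat.le_add_left k n)
  simp only [Nat.add_sub_cancel, Nat.sub_zero] at key
  rw [key, Nat.descFactorial_eq_factorial_mul_choose]
  push_cast
  ring
end

section
/- Let h be a permutation of a finite set X and let s ≠ t be two points of X. If s and t lie in the same cycle of h, then the cycle type of (s t)·h is obtained from the cycle type of h by a cut (removing one part n, the length of the common cycle, and adding those of i and n−i that are at least 2, where t = h^i(s), 0 < i < n); if s and t lie in different cycles of h of lengths i and j (counting fixed points as cycles of length 1), then the cycle type of (s t)·h is obtained from that of h by a join (removing those of i and j that are at least 2 and adding one part i+j). Consequently, for every transposition τ, the cycle type of τ·h is either a cut or a join of the cycle type of h. -/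
namespace List

variable {α : Type*} [DecidableEq α]

theorem swap_mul_formPerm_append (s t : α) (a b : List α) (ht : t ∉ s :: a) :
    Equiv.swap s t * formPerm (s :: a ++ t :: b) = formPerm (s :: a) * formPerm (t :: b) := by
  induction a generalizing s with
  | nil => simp
  | cons c a ih =>
    have hts : t ≠ s := fun h => ht (by simp [h])
    have htc : t ≠ c := fun h => ht (by simp [h])
    have key : Equiv.swap s t * Equiv.swap s c = Equiv.swap s c * Equiv.swap c t := by
      rw [Equiv.mul_swap_eq_swap_mul (Equiv.swap s c) c t, Equiv.swap_apply_right,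
        Equiv.swap_apply_of_ne_of_ne hts htc]
    have ih := ih c fun h => ht (mem_cons_of_mem _ h)
    simp only [cons_append, formPerm_cons_cons] at ih ⊢
    rw [← mul_assoc, key, mul_assoc, ih, mul_assoc]

theorem cycleType_formPerm_eq_filter [Fintype α] {l : List α} (hl : l.Nodup) :
    l.formPerm.cycleType = Multiset.filter (2 ≤ ·) {l.length} := by
  by_cases h : 2 ≤ l.length
  · rw [(isCycle_formPerm hl h).cycleType, support_formPerm_of_nodup l hl, toFinset_card_of_nodup hl]
    · simp [Multiset.filter_singleton, h]
    · rintro x rfl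
      simp at h
  · rw [(formPerm_eq_one_iff l hl).2 (by lia)]
    simp [Multiset.filter_singleton, h]

theorem cycleType_formPerm_mul [Fintype α] {l : List α} (hl : l.Nodup) {g : Equiv.Perm α}
    (hg : ∀ x ∈ l, g x = x) :
    (l.formPerm * g).cycleType = Multiset.filter (2 ≤ ·) {l.length} + g.cycleType := by
  have hd : l.formPerm.Disjoint g := fun x =>
    (em (x ∈ l)).elim (fun h => Or.inr (hg x h)) fun h => Or.inl (formPerm_apply_of_notMem h)
  rw [hd.cycleType_mul, cycleType_formPerm_eq_filter hl]

theorem inv_formPerm_apply_of_notMem {l : List α} {x : α} (hx : x ∉ l) :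
    l.formPerm⁻¹ x = x := by
  rw [Equiv.Perm.inv_eq_iff_eq, formPerm_apply_of_notMem hx]

end List

namespace Equiv.Perm

variable {α : Type*} (h : Perm α) (x : α)

/-- The points `x, h x, h² x, …` of the cycle of `h` through `x`, each listed once. -/
noncomputable def orbitList : List α := List.iterate h x (Function.minimalPeriod h x)

theorem length_orbitList : (h.orbitList x).length = Function.minimalPeriod h x :=
  List.length_iterate ..

theorem nodup_orbitList : (h.orbitList x).Nodup := by
  rw [List.nodup_iff_injective_get]
  rintro ⟨i, hi⟩ ⟨j, hj⟩ hij
  simp only [List.get_eq_getElem, orbitList, List.getElem_iterate] at hij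
  rw [length_orbitList] at hi hj
  exact Fin.ext (Function.iterate_injOn_Iio_minimalPeriod hi hj hij)

variable {h x}

theorem exists_iterate_of_mem_orbitList {y : α} (hy : y ∈ h.orbitList x) :
    ∃ k : ℕ, h^[k] x = y := by
  obtain ⟨k, _, rfl⟩ := List.mem_iterate.1 hy
  exact ⟨k, rfl⟩

theorem sameCycle_of_mem_orbitList {y : α} (hy : y ∈ h.orbitList x) : h.SameCycle x y := by
  obtain ⟨k, rfl⟩ := exists_iterate_of_mem_orbitList hy
  exact ⟨k, by rw [zpow_natCast, iterate_eq_pow]⟩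

theorem formPerm_orbitList_apply [DecidableEq α] {y : α} (hy : y ∈ h.orbitList x) :
    (h.orbitList x).formPerm y = h y := by
  obtain ⟨k, hk, rfl⟩ := List.getElem_of_mem hy
  rw [List.formPerm_apply_getElem _ (nodup_orbitList h x)]
  simp only [orbitList, List.getElem_iterate, List.length_iterate]
  rw [Function.iterate_mod_minimalPeriod_eq, Function.iterate_succ_apply']

theorem inv_formPerm_orbitList_mul_apply [DecidableEq α] {y : α} (hy : y ∈ h.orbitList x) :
    ((h.orbitList x).formPerm⁻¹ * h) y = y := by
  rw [mul_apply, inv_eq_iff_eq, formPerm_orbitList_apply hy]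

theorem orbitList_eq_cons [Finite α] : ∃ l, h.orbitList x = x :: l := by
  have hpos : 0 < Function.minimalPeriod h x :=
    Function.minimalPeriod_pos_of_mem_periodicPts (h.injective.mem_periodicPts x)
  obtain ⟨n, hn⟩ := Nat.exists_eq_succ_of_ne_zero hpos.ne'
  exact ⟨List.iterate h (h x) n, by rw [orbitList, hn, List.iterate]⟩

theorem orbitList_eq_append {i : ℕ} (hi : 0 < i) (hin : i < Function.minimalPeriod h x) :
    ∃ a b, h.orbitList x = x :: a ++ (h ^ i) x :: b ∧ (x :: a).length = i := by
  obtain ⟨m, rfl⟩ := Nat.exists_eq_succ_of_ne_zero hi.ne'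
  obtain ⟨k, hk⟩ := Nat.exists_eq_add_of_lt hin
  refine ⟨List.iterate h (h x) m, List.iterate h (h ((h ^ (m + 1)) x)) k, ?_, by simp⟩
  rw [orbitList, hk, add_assoc, List.iterate_add]
  simp [List.iterate, iterate_eq_pow, pow_succ]

variable [Fintype α] [DecidableEq α]

theorem cycleType_swap_mul_of_pow_apply_eq {s t : α} {i : ℕ} (hi : 0 < i)
    (hin : i < Function.minimalPeriod h s) (hit : (h ^ i) s = t) :
    (swap s t * h).cycleType = h.cycleType.erase (Function.minimalPeriod h s)
      + Multiset.filter (fun k => 2 ≤ k) {i, Function.minimalPeriod h s - i} := by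
  obtain ⟨a, b, hab, hlen⟩ := orbitList_eq_append hi hin
  rw [hit] at hab
  obtain ⟨g, hg⟩ : ∃ g, g = (h.orbitList s).formPerm⁻¹ * h := ⟨_, rfl⟩
  have hfix : ∀ y ∈ h.orbitList s, g y = y := fun y hy => by
    rw [hg, inv_formPerm_orbitList_mul_apply hy]
  have hh : h = (h.orbitList s).formPerm * g := by rw [hg, mul_inv_cancel_left]
  have hnd := nodup_orbitList h s
  have hln := length_orbitList h s
  have hct := List.cycleType_formPerm_mul hnd hfix
  rw [← hh, hln, Multiset.filter_singleton, if_pos (by lia : 2 ≤ _)] at hct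
  rw [hab] at hh hnd hfix hln
  rw [List.length_append, hlen] at hln
  obtain ⟨hna, hnb, hdis⟩ := List.nodup_append'.1 hnd
  have hta : t ∉ s :: a := fun hm => hdis hm (by simp)
  have hsw : swap s t * h = (s :: a).formPerm * ((t :: b).formPerm * g) := by
    conv_lhs => rw [hh]
    rw [← mul_assoc, List.swap_mul_formPerm_append s t a b hta, mul_assoc]
  have hfb : ∀ y ∈ t :: b, g y = y := fun y hy => hfix y (List.mem_append_right _ hy)
  rw [hsw, List.cycleType_formPerm_mul hna, List.cycleType_formPerm_mul hnb hfb, hct, hlen,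
    show (t :: b).length = Function.minimalPeriod h s - i by lia]
  · rw [Multiset.singleton_add, Multiset.erase_cons_head, ← add_assoc, ← Multiset.filter_add,
      add_comm, Multiset.singleton_add, Multiset.insert_eq_cons]
  · intro y hy
    rw [mul_apply, hfix y (List.mem_append_left _ hy),
      List.formPerm_apply_of_notMem fun hm => hdis hy hm]

theorem cycleType_swap_mul_of_not_sameCycle {s t : α} (hst : ¬ h.SameCycle s t) :
    (swap s t * h).cycleType = (h.cycleType - Multiset.filter (fun k => 2 ≤ k)
        {Function.minimalPeriod h s, Function.minimalPeriod h t})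
      + {Function.minimalPeriod h s + Function.minimalPeriod h t} := by
  obtain ⟨a, ha⟩ := orbitList_eq_cons (h := h) (x := s)
  obtain ⟨b, hb⟩ := orbitList_eq_cons (h := h) (x := t)
  have hdis : List.Disjoint (h.orbitList s) (h.orbitList t) := fun y hs ht =>
    hst ((sameCycle_of_mem_orbitList hs).trans (sameCycle_of_mem_orbitList ht).symm)
  obtain ⟨g, hg⟩ : ∃ g, g = (h.orbitList t).formPerm⁻¹ * ((h.orbitList s).formPerm⁻¹ * h) :=
    ⟨_, rfl⟩
  have hh : h = (h.orbitList s).formPerm * ((h.orbitList t).formPerm * g) := by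
    rw [hg, mul_inv_cancel_left, mul_inv_cancel_left]
  have hfs : ∀ y ∈ h.orbitList s, g y = y := fun y hy => by
    rw [hg, mul_apply, inv_formPerm_orbitList_mul_apply hy,
      List.inv_formPerm_apply_of_notMem fun hm => hdis hy hm]
  have hft : ∀ y ∈ h.orbitList t, g y = y := fun y hy => by
    have hm : h y ∈ h.orbitList t := by
      rw [← formPerm_orbitList_apply hy]
      exact List.formPerm_apply_mem_of_mem hy
    rw [hg, mul_apply, mul_apply, List.inv_formPerm_apply_of_notMem fun hm' => hdis hm' hm,
      inv_eq_iff_eq, formPerm_orbitList_apply hy]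
  have hns := nodup_orbitList h s
  have hnt := nodup_orbitList h t
  have hls := length_orbitList h s
  have hlt := length_orbitList h t
  have hfs' : ∀ y ∈ h.orbitList s, ((h.orbitList t).formPerm * g) y = y := fun y hy => by
    rw [mul_apply, hfs y hy, List.formPerm_apply_of_notMem fun hm => hdis hy hm]
  have hct := List.cycleType_formPerm_mul hns hfs'
  rw [← hh, List.cycleType_formPerm_mul hnt hft, hls, hlt, ← add_assoc, ← Multiset.filter_add,
    Multiset.singleton_add, ← Multiset.insert_eq_cons] at hct
  have hnd : (h.orbitList s ++ h.orbitList t).Nodup := List.nodup_append'.2 ⟨hns, hnt, hdis⟩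
  have hsw : swap s t * h = (h.orbitList s ++ h.orbitList t).formPerm * g := by
    have hta : t ∉ s :: a := fun hm => hdis (ha ▸ hm) (by simp [hb])
    have hjoin := List.swap_mul_formPerm_append s t a b hta
    rw [← ha, ← hb] at hjoin
    conv_lhs => rw [hh]
    rw [← mul_assoc (List.formPerm _), ← hjoin, mul_assoc, swap_mul_self_mul]
  rw [hsw, List.cycleType_formPerm_mul hnd, hct, List.length_append, hls, hlt,
    Multiset.filter_singleton, if_pos, add_tsub_cancel_left, add_comm]
  · have hs : 0 < Function.minimalPeriod h s := by rw [← hls, ha]; simp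
    have ht : 0 < Function.minimalPeriod h t := by rw [← hlt, hb]; simp
    lia
  · intro y hy
    exact (List.mem_append.1 hy).elim (hfs y) (hft y)

end Equiv.Perm


/-- Cut-and-join for permutations.  Let `h` be a permutation of a finite set `X` and let
`s ≠ t` be two points of `X`.  The length of the cycle of `h` containing a point `x`
(counting fixed points as cycles of length 1) is `Function.minimalPeriod h x`.

* (Cut) If `s` and `t` lie in the same cycle of `h`, of length `n`, and `t = h^i(s)` with
  `0 < i < n`, then the cycle type of `(s t)·h` is obtained from that of `h` by removing
  one part `n` and adding those of `i` and `n − i` that are at least 2.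
* (Join) If `s` and `t` lie in different cycles of `h`, of lengths `i` and `j`, then the
  cycle type of `(s t)·h` is obtained from that of `h` by removing those of `i` and `j`
  that are at least 2 and adding one part `i + j`.

Consequently, for every transposition `τ`, the cycle type of `τ·h` is either a cut or a
join of the cycle type of `h`. -/
theorem cycleType_swap_mul_cut_or_join {X : Type*} [Fintype X] [DecidableEq X]
    (h : Equiv.Perm X) (s t : X) (hst : s ≠ t) :
    (h.SameCycle s t →
      ∀ i : ℕ, 0 < i → i < Function.minimalPeriod h s → (h ^ i) s = t →
        (Equiv.swap s t * h).cycleType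
          = h.cycleType.erase (Function.minimalPeriod h s)
              + Multiset.filter (fun k => 2 ≤ k) {i, Function.minimalPeriod h s - i})
    ∧ (¬ h.SameCycle s t →
        (Equiv.swap s t * h).cycleType
          = (h.cycleType
                - Multiset.filter (fun k => 2 ≤ k)
                    {Function.minimalPeriod h s, Function.minimalPeriod h t})
              + {Function.minimalPeriod h s + Function.minimalPeriod h t}) := by
  exact ⟨fun _ _ hi hin hit => Equiv.Perm.cycleType_swap_mul_of_pow_apply_eq hi hin hit,
    Equiv.Perm.cycleType_swap_mul_of_not_sameCycle⟩
end
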